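/- Let (A,m) be a multiarrangement on an essential arrangement A in K^ℓ and H ∈ A. If (A,m) and the Euler restriction (A^H, m^*) are both free, then (A, m−δ_H) is tame. -/

import Mathlib

noncomputable section
open Classical MvPolynomial

/-- `pdLE R n M` : the `R`-module `M` has projective dimension at most `n`. -/
def pdLE (R : Type) [CommRing R] : ℕ → (M : Type) → [AddCommGroup M] → [Module R M] → Prop
  | 0, M, _, _ => Module.Projective R M
  | n + 1, M, _, _ => ∃ (ι : Type) (f : (ι →₀ R) →ₗ[R] M),
      Function.Surjective f ∧ pdLE R n (LinearMap.ker f)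

/-- Projective dimension as an element of `ℕ∞`. -/
def pdim (R : Type) [CommRing R] (M : Type) [AddCommGroup M] [Module R M] : ℕ∞ :=
  sInf {n : ℕ∞ | ∃ k : ℕ, pdLE R k M ∧ n = (k : ℕ∞)}

/-- The coordinate ring `S = K[x_1, …, x_ℓ]`. -/
abbrev PS (K : Type) [Field K] (ℓ : ℕ) : Type := MvPolynomial (Fin ℓ) K

/-- The free `S`-module of polynomial differential forms of all degrees, realized as the
exterior algebra over `S` on the free module `S^ℓ` (with `dx_i` the standard basis). -/
abbrev ExtF (K : Type) [Field K] (ℓ : ℕ) : Type :=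
  ExteriorAlgebra (PS K ℓ) (Fin ℓ → PS K ℓ)

variable {K : Type} [Field K] {ℓ : ℕ}

/-- The module `Ω^p_V` of polynomial differential `p`-forms. -/
def formsP (K : Type) [Field K] (ℓ : ℕ) (p : ℕ) : Submodule (PS K ℓ) (ExtF K ℓ) :=
  (LinearMap.range (ExteriorAlgebra.ι (PS K ℓ) :
      (Fin ℓ → PS K ℓ) →ₗ[PS K ℓ] ExtF K ℓ)) ^ p

/-- The defining linear form `α = ∑ c_i x_i` of the hyperplane with coefficient vector `c`. -/
def linP (c : Fin ℓ → K) : PS K ℓ := ∑ i, MvPolynomial.C (c i) * MvPolynomial.X i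

/-- The constant one-form `dα = ∑ c_i dx_i`. -/
def dP (c : Fin ℓ → K) : ExtF K ℓ :=
  ExteriorAlgebra.ι (PS K ℓ) (fun i => MvPolynomial.C (c i))

/-- A central hyperplane arrangement in `K^ℓ`: a finite set of (pairwise non-proportional,
nonzero) coefficient vectors of defining linear forms, each representing the hyperplane
`{x : ∑ c_i x_i = 0}`. -/
structure Arrangement (K : Type) [Field K] (ℓ : ℕ) : Type where
  hyps : Finset (Fin ℓ → K)
  ne_zero : ∀ c ∈ hyps, c ≠ 0
  nonprop : ∀ c ∈ hyps, ∀ c' ∈ hyps, c ≠ c' → ∀ t : K, c ≠ t • c'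

/-- The polynomial model of the module `Ω^p(A,m)` of logarithmic `p`-forms of the
multiarrangement `(A,m)`; it is `Q(A,m)·Ω^p(A,m)`, i.e. the image of `Ω^p(A,m)` under the
degree-shifting isomorphism given by multiplication with `Q(A,m)`, so that
`η = Q(A,m)·ω` ranges over polynomial `p`-forms with `dα_H ∧ η ∈ α_H^{m(H)} Ω^{p+1}_V`
for all `H ∈ A`. -/
def Omega (A : Arrangement K ℓ) (m : (Fin ℓ → K) → ℕ) (p : ℕ) :
    Submodule (PS K ℓ) (ExtF K ℓ) :=
  formsP K ℓ p ⊓ ⨅ c ∈ A.hyps,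
    Submodule.comap (LinearMap.mulLeft (PS K ℓ) (dP c))
      (Submodule.map (LinearMap.lsmul (PS K ℓ) (ExtF K ℓ) (linP c ^ m c))
        (formsP K ℓ (p + 1)))

/-- Tameness of a multiarrangement: `pd_S Ω^p(A,m) ≤ p` for all `0 ≤ p ≤ ℓ`. -/
def TameM (A : Arrangement K ℓ) (m : (Fin ℓ → K) → ℕ) : Prop :=
  ∀ p : ℕ, p ≤ ℓ → pdLE (PS K ℓ) p (Omega A m p)

/-- Tameness of a simple arrangement (constant multiplicity `1`). -/
def Tame (A : Arrangement K ℓ) : Prop := TameM A (fun _ => 1)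

/-- Freeness of a multiarrangement: `Ω^1(A,m)` is a free `S`-module. -/
def FreeM (A : Arrangement K ℓ) (m : (Fin ℓ → K) → ℕ) : Prop :=
  Module.Free (PS K ℓ) (Omega A m 1)

/-- An arrangement is essential when the intersection of its hyperplanes is `{0}`,
equivalently the defining forms span the dual space. -/
def Essential (A : Arrangement K ℓ) : Prop :=
  Submodule.span K (A.hyps : Set (Fin ℓ → K)) = ⊤

/-- The localization `A_x = {H ∈ A : x ∈ H}` of an arrangement at a point `x`. -/
def locArr (A : Arrangement K ℓ) (x : Fin ℓ → K) : Arrangement K ℓ where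
  hyps := A.hyps.filter (fun c => ∑ i, c i * x i = 0)
  ne_zero := fun c hc => A.ne_zero c (Finset.mem_filter.mp hc).1
  nonprop := fun c hc c' hc' =>
    A.nonprop c (Finset.mem_filter.mp hc).1 c' (Finset.mem_filter.mp hc').1

/-- `(A,m)` is locally free along the hyperplane `{x : ∑ (c0)_i x_i = 0}` :
`(A_x, m_x)` is free for every nonzero point `x` of this hyperplane. -/
def LocallyFreeAlong (A : Arrangement K ℓ) (m : (Fin ℓ → K) → ℕ) (c0 : Fin ℓ → K) : Prop :=
  ∀ x : Fin ℓ → K, x ≠ 0 → (∑ i, c0 i * x i = 0) → FreeM (locArr A x) m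

/-- The deletion `A ∖ {H}`. -/
def delArr (A : Arrangement K ℓ) (c0 : Fin ℓ → K) : Arrangement K ℓ where
  hyps := A.hyps.erase c0
  ne_zero := fun c hc => A.ne_zero c (Finset.mem_of_mem_erase hc)
  nonprop := fun c hc c' hc' =>
    A.nonprop c (Finset.mem_of_mem_erase hc) c' (Finset.mem_of_mem_erase hc')

/-- The coefficient vector of the restriction of the linear form `c` to the hyperplane `H`
along the linear identification `e : K^{ℓ-1} ≃ H`. -/
def restrictForm (e : (Fin (ℓ - 1) → K) →ₗ[K] (Fin ℓ → K)) (c : Fin ℓ → K) :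
    Fin (ℓ - 1) → K := fun i => ∑ j, c j * e (Pi.single i 1) j

/-- The linear form on `K^ℓ` with coefficient vector `c`. -/
def dotLin (c : Fin ℓ → K) : (Fin ℓ → K) →ₗ[K] K := ∑ i, c i • LinearMap.proj i

/-- `e` identifies `K^{ℓ-1}` with the hyperplane `ker(α_{c0})`. -/
def IsHypEmbedding (c0 : Fin ℓ → K) (e : (Fin (ℓ - 1) → K) →ₗ[K] (Fin ℓ → K)) : Prop :=
  Function.Injective e ∧ LinearMap.range e = LinearMap.ker (dotLin c0)

/-- `B` (an arrangement in `K^{ℓ-1}`) represents the restriction `A^H` of `A` to the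
hyperplane `H` determined by `c0 ∈ A`, via the identification `e : K^{ℓ-1} ≃ H`:
its hyperplanes are exactly the restrictions to `H` of the hyperplanes of `A ∖ {H}`. -/
def IsRestrictionOf (B : Arrangement K (ℓ - 1)) (A : Arrangement K ℓ) (c0 : Fin ℓ → K)
    (e : (Fin (ℓ - 1) → K) →ₗ[K] (Fin ℓ → K)) : Prop :=
  (∀ c ∈ A.hyps, c ≠ c0 → ∃ c' ∈ B.hyps, ∃ t : K, t ≠ 0 ∧ restrictForm e c = t • c') ∧
  (∀ c' ∈ B.hyps, ∃ c ∈ A.hyps, c ≠ c0 ∧ ∃ t : K, t ≠ 0 ∧ restrictForm e c = t • c')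
/-- The Ziegler multiplicity `m^H` on the restriction: `m^H(X) = #{L ∈ A∖{H} : L ∩ H = X}`. -/
def zieglerMult (A : Arrangement K ℓ) (c0 : Fin ℓ → K)
    (e : (Fin (ℓ - 1) → K) →ₗ[K] (Fin ℓ → K)) (c' : Fin (ℓ - 1) → K) : ℕ :=
  (A.hyps.filter (fun c => c ≠ c0 ∧ ∃ t : K, t ≠ 0 ∧ restrictForm e c = t • c')).card

/-- The wedge `dx_{i_1} ∧ ⋯ ∧ dx_{i_p}` for a list of indices. -/
def wedgeList (l : List (Fin ℓ)) : ExtF K ℓ :=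
  (l.map (fun i => ExteriorAlgebra.ι (PS K ℓ) (Pi.single i (1 : PS K ℓ)))).prod

/-- A polynomial `p`-form is homogeneous of (coefficient) degree `d` if it is a sum of
terms `f · dx_{i_1} ∧ ⋯ ∧ dx_{i_p}` with `f` homogeneous of degree `d`. -/
def IsHomogForm (p d : ℕ) (η : ExtF K ℓ) : Prop :=
  η ∈ AddSubgroup.closure {ξ : ExtF K ℓ | ∃ (f : PS K ℓ) (l : List (Fin ℓ)),
    f.IsHomogeneous d ∧ l.length = p ∧ ξ = f • wedgeList l}

/-- `|m| = ∑_{H ∈ A} m(H)`. -/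
def msum (A : Arrangement K ℓ) (m : (Fin ℓ → K) → ℕ) : ℕ := ∑ c ∈ A.hyps, m c

/-- The multiarrangement `(A,m)` is free with exponents `(d_1, …, d_ℓ)`: the polynomial
model of `Ω^1(A,m)` has a homogeneous basis whose `i`-th member has coefficient degree
`|m| - d_i`. -/
def FreeWithExp (A : Arrangement K ℓ) (m : (Fin ℓ → K) → ℕ) (d : Fin ℓ → ℕ) : Prop :=
  ∃ b : Fin ℓ → ExtF K ℓ,
    (∀ i, b i ∈ Omega A m 1) ∧
    (∀ i, IsHomogForm 1 (msum A m - d i) (b i)) ∧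
    LinearIndependent (PS K ℓ) b ∧
    Omega A m 1 ≤ Submodule.span (PS K ℓ) (Set.range b)

/-- The exponent vector `(d_1, d_2, 0, …, 0)`. -/
def expVec (d1 d2 : ℕ) : Fin ℓ → ℕ := fun i =>
  if (i : ℕ) = 0 then d1 else if (i : ℕ) = 1 then d2 else 0

/-- The localization `A_X` of `A` at the lattice element `X = H ∩ L` corresponding,
via the identification `e` of `H` with `K^{ℓ-1}`, to the hyperplane of `H`
with coefficient vector `c'`. -/
def locOnRestr (A : Arrangement K ℓ) (e : (Fin (ℓ - 1) → K) →ₗ[K] (Fin ℓ → K))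
    (c' : Fin (ℓ - 1) → K) : Arrangement K ℓ where
  hyps := A.hyps.filter (fun c => ∃ t : K, restrictForm e c = t • c')
  ne_zero := fun c hc => A.ne_zero c (Finset.mem_filter.mp hc).1
  nonprop := fun c hc c'' hc'' =>
    A.nonprop c (Finset.mem_filter.mp hc).1 c'' (Finset.mem_filter.mp hc'').1

/-- The multiplicity `m - δ_H`. -/
def mdel (m : (Fin ℓ → K) → ℕ) (c0 : Fin ℓ → K) : (Fin ℓ → K) → ℕ :=
  fun c => if c = c0 then m c - 1 else m c

/-- `ms` is the Euler multiplicity `m^*` on the restriction `B = A^H` (presented via the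
identification `e`): for each `X ∈ A^H` the rank-two localization `(A_X, m_X)` is free
with exponents `(d_1^X, d_2^X, 0, …, 0)` ordered so that `(A_X, m_X - δ_H)` is free with
exponents `(d_1^X - 1, d_2^X, 0, …, 0)`, and `m^*(X) = d_2^X`. -/
def IsEulerMult (A : Arrangement K ℓ) (m : (Fin ℓ → K) → ℕ) (c0 : Fin ℓ → K)
    (e : (Fin (ℓ - 1) → K) →ₗ[K] (Fin ℓ → K)) (B : Arrangement K (ℓ - 1))
    (ms : (Fin (ℓ - 1) → K) → ℕ) : Prop :=
  ∀ c' ∈ B.hyps, ∃ d1 d2 : ℕ,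
    FreeWithExp (locOnRestr A e c') m (expVec d1 d2) ∧
    FreeWithExp (locOnRestr A e c') (mdel m c0) (expVec (d1 - 1) d2) ∧
    ms c' = d2

/-- An arrangement is generic if any `k ≤ ℓ-1` of its hyperplanes intersect in
codimension `k`, i.e. any `≤ ℓ-1` of its defining forms are linearly independent. -/
def GenericArr (A : Arrangement K ℓ) : Prop :=
  ∀ s : Finset (Fin ℓ → K), s ⊆ A.hyps → s.card ≤ ℓ - 1 →
    LinearIndependent K (fun x : {c // c ∈ s} => (x : Fin ℓ → K))

/-- An arrangement is irreducible if it is not a product of two lower-dimensional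
arrangements, i.e. its defining forms cannot be split into two complementary proper
subspaces of the dual space. -/
def IrreducibleArr (A : Arrangement K ℓ) : Prop :=
  ¬ ∃ U1 U2 : Submodule K (Fin ℓ → K), U1 ≠ ⊥ ∧ U2 ≠ ⊥ ∧ U1 ⊓ U2 = ⊥ ∧ U1 ⊔ U2 = ⊤ ∧
      ∀ c ∈ A.hyps, c ∈ U1 ∨ c ∈ U2

/-- The defining polynomial `Q(A,m) = ∏_{H ∈ A} α_H^{m(H)}`. -/
def Qpoly (A : Arrangement K ℓ) (m : (Fin ℓ → K) → ℕ) : PS K ℓ :=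
  ∏ c ∈ A.hyps, linP c ^ m c

section ProjectiveDimension

theorem pdLE_succ {R : Type} [CommRing R] (n : ℕ) : ∀ (M : Type) [AddCommGroup M] [Module R M],
    pdLE R n M → pdLE R (n + 1) M := by
  induction n with
  | zero =>
    intro M _ _ h
    have hM : Module.Projective R M := h
    refine ⟨M, Finsupp.linearCombination R id, Finsupp.linearCombination_id_surjective R M, ?_⟩
    obtain ⟨s, hs⟩ := Module.projective_lifting_property
      (Finsupp.linearCombination R (id : M → M)) LinearMap.id
      (Finsupp.linearCombination_id_surjective R M)
    have hsx : ∀ x, Finsupp.linearCombination R (id : M → M) (s x) = x :=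
      fun x => LinearMap.congr_fun hs x
    refine Module.Projective.of_split
      (LinearMap.ker (Finsupp.linearCombination R (id : M → M))).subtype
      (LinearMap.codRestrict _
        (LinearMap.id - s ∘ₗ Finsupp.linearCombination R (id : M → M)) ?_) ?_
    · intro x
      simp [hsx]
    · ext x : 2
      have hx : Finsupp.linearCombination R (id : M → M) x.1 = 0 := x.2
      simp [hx]
  | succ n ih =>
    rintro M _ _ ⟨ι, f, hf, hk⟩
    exact ⟨ι, f, hf, ih _ hk⟩

theorem pdLE_mono {R : Type} [CommRing R] {M : Type} [AddCommGroup M] [Module R M] {n k : ℕ}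
    (hnk : n ≤ k) (h : pdLE R n M) : pdLE R k M := by
  induction hnk with
  | refl => exact h
  | step _ ih => exact pdLE_succ _ _ ih

/-- Schanuel's lemma, in the form: projectivity of the kernel of a projective cover of `N`
does not depend on the cover. -/
theorem projective_ker_of_projective_ker {R N P P' : Type} [CommRing R] [AddCommGroup N]
    [Module R N] [AddCommGroup P] [Module R P] [AddCommGroup P'] [Module R P']
    [Module.Projective R P] [Module.Projective R P'] (f : P →ₗ[R] N) (g : P' →ₗ[R] N)
    (hf : Function.Surjective f) (hg : Function.Surjective g)
    (hk : Module.Projective R (LinearMap.ker f)) : Module.Projective R (LinearMap.ker g) := by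
  obtain ⟨a, ha⟩ := Module.projective_lifting_property f g hf
  obtain ⟨b, hb⟩ := Module.projective_lifting_property g f hg
  have ha' : ∀ x, f (a x) = g x := fun x => LinearMap.congr_fun ha x
  have hb' : ∀ x, g (b x) = f x := fun x => LinearMap.congr_fun hb x
  let i : LinearMap.ker g →ₗ[R] LinearMap.ker f × P' :=
    LinearMap.prod (LinearMap.codRestrict _ (a ∘ₗ (LinearMap.ker g).subtype)
      (fun x => by simp [ha'])) (LinearMap.ker g).subtype
  let s : LinearMap.ker f × P' →ₗ[R] LinearMap.ker g :=
    LinearMap.coprod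
      (LinearMap.codRestrict _ (b ∘ₗ (LinearMap.ker f).subtype) (fun x => by simp [hb']))
      (LinearMap.codRestrict _ (LinearMap.id - b ∘ₗ a) (fun x => by simp [hb', ha']))
  refine Module.Projective.of_split i s ?_
  ext x
  change b (a x.1) + (x.1 - b (a x.1)) = x.1
  abel

/-- A retract of a module with a projective presentation of length one has projective
dimension at most one. -/
theorem pdLE_one_of_retract {R M N P : Type} [CommRing R] [AddCommGroup M] [Module R M]
    [AddCommGroup N] [Module R N] [AddCommGroup P] [Module R P] [Module.Projective R P]
    (i : M →ₗ[R] N) (s : N →ₗ[R] M) (hsi : ∀ x, s (i x) = x) (f : P →ₗ[R] N)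
    (hf : Function.Surjective f) (hk : Module.Projective R (LinearMap.ker f)) :
    pdLE R 1 M := by
  let p : (M →₀ R) →ₗ[R] M := Finsupp.linearCombination R id
  let q : (LinearMap.ker s →₀ R) →ₗ[R] LinearMap.ker s := Finsupp.linearCombination R id
  have hp : Function.Surjective p := Finsupp.linearCombination_id_surjective R M
  have hq : Function.Surjective q := Finsupp.linearCombination_id_surjective R _
  refine ⟨M, p, hp, ?_⟩
  let g : (M →₀ R) × (LinearMap.ker s →₀ R) →ₗ[R] N :=
    LinearMap.coprod (i ∘ₗ p) ((LinearMap.ker s).subtype ∘ₗ q)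
  have hg : Function.Surjective g := by
    intro n
    obtain ⟨x, hx⟩ := hp (s n)
    obtain ⟨y, hy⟩ := hq ⟨n - i (s n), by simp [hsi]⟩
    exact ⟨(x, y), by simp [g, hx, hy]⟩
  have hkg := projective_ker_of_projective_ker f g hf hg hk
  refine Module.Projective.of_split (P := LinearMap.ker p) (M := LinearMap.ker g)
    (LinearMap.codRestrict _ (LinearMap.inl R _ _ ∘ₗ (LinearMap.ker p).subtype) ?_)
    (LinearMap.codRestrict _ (LinearMap.fst R _ _ ∘ₗ (LinearMap.ker g).subtype) ?_) ?_
  · intro x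
    simp [g]
  · intro x
    have h : g x.1 = 0 := x.2
    have h1 : s (g x.1) = p x.1.1 := by
      change s (i (p x.1.1) + (q x.1.2 : N)) = p x.1.1
      rw [map_add, hsi, LinearMap.map_coe_ker, add_zero]
    rw [h, map_zero] at h1
    exact h1.symm
  · ext x : 2
    rfl

end ProjectiveDimension

section FreeModules

variable {R F : Type} [CommRing R] [AddCommGroup F] [Module R F]

theorem exists_eq_smul_of_forall_repr {ι : Type} (b : Module.Basis ι R F) (d : R) (x : F)
    (h : ∀ j, d ∣ b.repr x j) : ∃ y, x = d • y := by
  choose q hq using h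
  refine ⟨∑ j ∈ (b.repr x).support, q j • b j, ?_⟩
  conv_lhs => rw [← b.linearCombination_repr x, Finsupp.linearCombination_apply, Finsupp.sum]
  rw [Finset.smul_sum]
  exact Finset.sum_congr rfl fun j _ => by rw [hq j, mul_smul]

theorem exists_eq_prod_smul [Module.Free R F] [IsDomain R] [DecompositionMonoid R] {ι : Type}
    (s : Finset ι) (d : ι → R) (hd : (s : Set ι).Pairwise (Function.onFun IsRelPrime d)) (x : F)
    (h : ∀ i ∈ s, ∃ y, x = d i • y) : ∃ y, x = (∏ i ∈ s, d i) • y := by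
  refine exists_eq_smul_of_forall_repr (Module.Free.chooseBasis R F) _ _ fun j => ?_
  refine Finset.prod_dvd_of_isRelPrime hd fun i hi => ?_
  obtain ⟨y, rfl⟩ := h i hi
  exact ⟨(Module.Free.chooseBasis R F).repr y j, by simp⟩

theorem smul_cancel [Module.Free R F] [IsDomain R] {d : R} (hd : d ≠ 0) {x y : F}
    (h : d • x = d • y) : x = y := by
  apply (Module.Free.chooseBasis R F).repr.injective
  ext j
  have := congrArg (fun z => (Module.Free.chooseBasis R F).repr z j) h
  simpa [hd] using this

/-- If `d` is coprime to `c` and `d ∣ c • x`, then `d ∣ x`. -/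
theorem exists_eq_smul_of_isRelPrime [Module.Free R F] [IsDomain R] [DecompositionMonoid R]
    {c d : R} (hcd : IsRelPrime d c) {x y : F} (h : c • x = d • y) : ∃ z, x = d • z := by
  refine exists_eq_smul_of_forall_repr (Module.Free.chooseBasis R F) _ _ fun j => ?_
  refine hcd.dvd_of_dvd_mul_left ⟨(Module.Free.chooseBasis R F).repr y j, ?_⟩
  simpa using congrArg (fun z => (Module.Free.chooseBasis R F).repr z j) h

/-- A regular sequence argument on a free module, modulo the kernel of `φ`. -/
theorem exists_eq_smul_add_smul [Module.Free R F] {R' : Type} [CommRing R'] [IsDomain R']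
    [DecompositionMonoid R'] (φ : R →+* R') (hφ : Function.Surjective φ) {α : R}
    (hα : ∀ s, φ s = 0 → α ∣ s) (hα0 : φ α = 0) {f g : R} (hfg : IsRelPrime (φ g) (φ f)) {u v w : F}
    (h : f • u = g • v + α • w) : ∃ y z, u = g • y + α • z := by
  let b := Module.Free.chooseBasis R F
  have key : ∀ j, ∃ p q, b.repr u j = g * p + α * q := by
    intro j
    have h1 : f * b.repr u j = g * b.repr v j + α * b.repr w j := by
      simpa using congrArg (fun z => b.repr z j) h
    have h2 := congrArg φ h1
    simp only [map_mul, map_add, hα0, zero_mul, add_zero] at h2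
    obtain ⟨p, hp⟩ := hfg.dvd_of_dvd_mul_left ⟨_, h2⟩
    obtain ⟨p, rfl⟩ := hφ p
    obtain ⟨q, hq⟩ := hα (b.repr u j - g * p) (by rw [map_sub, hp, map_mul, sub_self])
    exact ⟨p, q, by rw [← hq]; ring⟩
  choose p q hpq using key
  refine ⟨∑ j ∈ (b.repr u).support, p j • b j, ∑ j ∈ (b.repr u).support, q j • b j, ?_⟩
  conv_lhs => rw [← b.linearCombination_repr u, Finsupp.linearCombination_apply, Finsupp.sum]
  rw [Finset.smul_sum, Finset.smul_sum, ← Finset.sum_add_distrib]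
  exact Finset.sum_congr rfl fun j _ => by rw [hpq j, add_smul, mul_smul, mul_smul]

end FreeModules

section LinearForms

theorem linP_add (c d : Fin ℓ → K) : linP (c + d) = linP c + linP d := by
  simp [linP, add_mul, Finset.sum_add_distrib]

theorem linP_smul (t : K) (c : Fin ℓ → K) : linP (t • c) = C t * linP c := by
  simp [linP, Finset.mul_sum, mul_assoc]

theorem linP_single (i : Fin ℓ) : linP (Pi.single i (1 : K)) = X i := by
  simp [linP, Pi.single_apply, apply_ite C, ite_mul]

theorem linP_isHomogeneous (c : Fin ℓ → K) : (linP c).IsHomogeneous 1 :=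
  IsHomogeneous.sum _ _ _ fun _ _ => isHomogeneous_C_mul_X _ _

theorem coeff_linP (c : Fin ℓ → K) (i : Fin ℓ) : coeff (Finsupp.single i 1) (linP c) = c i := by
  simp [linP, coeff_sum, coeff_C_mul, coeff_X, Finsupp.single_left_inj]

theorem linP_injective : Function.Injective (linP : (Fin ℓ → K) → PS K ℓ) := by
  intro c d h
  ext i
  rw [← coeff_linP c, h, coeff_linP]

theorem linP_ne_zero {c : Fin ℓ → K} (hc : c ≠ 0) : linP c ≠ 0 := by
  have : linP (0 : Fin ℓ → K) = 0 := by simp [linP]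
  rw [← this]
  exact linP_injective.ne hc

theorem linP_prime {c : Fin ℓ → K} (hc : c ≠ 0) : Prime (linP c) := by
  apply Irreducible.prime
  apply irreducible_of_totalDegree_eq_one
  · exact (linP_isHomogeneous c).totalDegree (linP_ne_zero hc)
  · intro x hx
    obtain ⟨i, hi⟩ := Function.ne_iff.mp hc
    have := hx (Finsupp.single i 1)
    rw [coeff_linP] at this
    rcases eq_or_ne x 0 with rfl | hx0
    · exact absurd (zero_dvd_iff.mp this) hi
    · exact isUnit_iff_ne_zero.mpr hx0

theorem linP_dvd_iff {c d : Fin ℓ → K} (hd : d ≠ 0) :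
    linP c ∣ linP d ↔ ∃ t : K, d = t • c := by
  constructor
  · rintro ⟨q, hq⟩
    have hd0 := linP_ne_zero hd
    have hc0 : linP c ≠ 0 := fun h => hd0 (by rw [hq, h, zero_mul])
    have hq0 : q ≠ 0 := fun h => hd0 (by rw [hq, h, mul_zero])
    have h1 := congrArg totalDegree hq
    rw [totalDegree_mul_of_isDomain hc0 hq0, (linP_isHomogeneous d).totalDegree hd0,
      (linP_isHomogeneous c).totalDegree hc0] at h1
    have h2 : q = C (coeff 0 q) := totalDegree_eq_zero_iff_eq_C.mp (by omega)
    refine ⟨coeff 0 q, linP_injective ?_⟩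
    rw [linP_smul, hq, mul_comm, ← h2]
  · rintro ⟨t, rfl⟩
    rw [linP_smul]
    exact dvd_mul_left _ _

theorem Arrangement.isRelPrime_pow (A : Arrangement K ℓ) (m m' : (Fin ℓ → K) → ℕ)
    {c d : Fin ℓ → K} (hc : c ∈ A.hyps) (hd : d ∈ A.hyps) (hcd : c ≠ d) :
    IsRelPrime (linP c ^ m c) (linP d ^ m' d) := by
  apply IsRelPrime.pow
  rw [(linP_prime (A.ne_zero c hc)).irreducible.isRelPrime_iff_not_dvd,
    linP_dvd_iff (A.ne_zero d hd)]
  rintro ⟨t, ht⟩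
  exact A.nonprop d hd c hc hcd.symm t ht

theorem Arrangement.pairwise_isRelPrime (A : Arrangement K ℓ) (m : (Fin ℓ → K) → ℕ) :
    (A.hyps : Set (Fin ℓ → K)).Pairwise (Function.onFun IsRelPrime fun c => linP c ^ m c) :=
  fun _ hc _ hd hcd => A.isRelPrime_pow m m hc hd hcd

theorem Qpoly_ne_zero (A : Arrangement K ℓ) (m : (Fin ℓ → K) → ℕ) : Qpoly A m ≠ 0 :=
  Finset.prod_ne_zero_iff.mpr fun c hc => pow_ne_zero _ (linP_ne_zero (A.ne_zero c hc))

theorem Qpoly_isHomogeneous (A : Arrangement K ℓ) (m : (Fin ℓ → K) → ℕ) :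
    (Qpoly A m).IsHomogeneous (msum A m) :=
  IsHomogeneous.prod _ _ _ fun c _ => by simpa using (linP_isHomogeneous c).pow (m c)

end LinearForms

section Exterior

variable {R M : Type} [CommRing R] [AddCommGroup M] [Module R M]

instance ExteriorAlgebra.free_of_free [Module.Free R M] : Module.Free R (ExteriorAlgebra R M) := by
  let _ := linearOrderOfSTO (α := Module.Free.ChooseBasisIndex R M) WellOrderingRel
  exact Module.Free.of_basis (Module.Free.chooseBasis R M).ExteriorAlgebra

theorem ExteriorAlgebra.mul_ι_eq (x : ExteriorAlgebra R M) (v : M) :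
    x * ExteriorAlgebra.ι R v = ExteriorAlgebra.ι R v * CliffordAlgebra.involute x := by
  induction x using ExteriorAlgebra.induction with
  | algebraMap r => rw [AlgHom.commutes, Algebra.commutes]
  | ι w =>
    have h := ExteriorAlgebra.ι_add_mul_swap (R := R) w v
    have h2 : CliffordAlgebra.involute (ExteriorAlgebra.ι R w) = - ExteriorAlgebra.ι R w :=
      CliffordAlgebra.involute_ι w
    rw [h2, mul_neg]
    exact eq_neg_of_add_eq_zero_left h
  | mul a b ha hb => rw [map_mul, mul_assoc, hb, ← mul_assoc, ha, mul_assoc]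
  | add a b ha hb => rw [map_add, add_mul, ha, hb, mul_add]

theorem ExteriorAlgebra.ι_mul_eq (x : ExteriorAlgebra R M) (v : M) :
    ExteriorAlgebra.ι R v * x = CliffordAlgebra.involute x * ExteriorAlgebra.ι R v := by
  rw [ExteriorAlgebra.mul_ι_eq]
  congr 1
  exact (CliffordAlgebra.involute_involute x).symm

theorem ExteriorAlgebra.ι_mul_mul_ι (x : ExteriorAlgebra R M) (v : M) :
    ExteriorAlgebra.ι R v * x * ExteriorAlgebra.ι R v = 0 := by
  rw [ExteriorAlgebra.ι_mul_eq, mul_assoc, ExteriorAlgebra.ι_sq_zero, mul_zero]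

theorem ExteriorAlgebra.ι_mul_ι_mul (v : M) (x : ExteriorAlgebra R M) :
    ExteriorAlgebra.ι R v * (ExteriorAlgebra.ι R v * x) = 0 := by
  rw [← mul_assoc, ExteriorAlgebra.ι_sq_zero, zero_mul]

/-- The projection onto the `p`-th exterior power. -/
def extProj (R M : Type) [CommRing R] [AddCommGroup M] [Module R M] (p : ℕ) :
    ExteriorAlgebra R M →ₗ[R] ExteriorAlgebra R M :=
  GradedAlgebra.proj (fun i : ℕ => ⋀[R]^i M) p

theorem extProj_mem (p : ℕ) (x : ExteriorAlgebra R M) : extProj R M p x ∈ ⋀[R]^p M :=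
  SetLike.coe_mem _

theorem extProj_of_mem {p : ℕ} {x : ExteriorAlgebra R M} (hx : x ∈ ⋀[R]^p M) :
    extProj R M p x = x :=
  DirectSum.decompose_of_mem_same (fun i : ℕ => ⋀[R]^i M) hx

theorem extProj_of_mem_ne {p q : ℕ} {x : ExteriorAlgebra R M} (hx : x ∈ ⋀[R]^p M) (hpq : p ≠ q) :
    extProj R M q x = 0 :=
  DirectSum.decompose_of_mem_ne (fun i : ℕ => ⋀[R]^i M) hx hpq

theorem extProj_ι_mul (v : M) (p : ℕ) (x : ExteriorAlgebra R M) :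
    extProj R M (p + 1) (ExteriorAlgebra.ι R v * x) = ExteriorAlgebra.ι R v * extProj R M p x := by
  have hv : ExteriorAlgebra.ι R v ∈ ⋀[R]^1 M := by
    change _ ∈ LinearMap.range (ExteriorAlgebra.ι R) ^ 1
    rw [pow_one]
    exact LinearMap.mem_range_self _ v
  have := DirectSum.coe_decompose_mul_add_of_left_mem (fun i : ℕ => ⋀[R]^i M) (i := 1) (j := p)
    (b := x) hv
  rw [add_comm] at this
  exact this

theorem exists_sum_extProj (x : ExteriorAlgebra R M) :
    ∃ s : Finset ℕ, x = ∑ p ∈ s, extProj R M p x :=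
  ⟨_, (DirectSum.sum_support_decompose (fun i : ℕ => ⋀[R]^i M) x).symm⟩

theorem ExteriorAlgebra.algHom_scale (θ : ExteriorAlgebra R M →ₐ[R] ExteriorAlgebra R M) (r : R)
    (hθ : ∀ v, θ (ExteriorAlgebra.ι R v) = r • ExteriorAlgebra.ι R v) {p : ℕ}
    {x : ExteriorAlgebra R M} (hx : x ∈ ⋀[R]^p M) : θ x = r ^ p • x := by
  refine Submodule.pow_induction_on_left' (LinearMap.range (ExteriorAlgebra.ι R))
    (C := fun n x _ => θ x = r ^ n • x) ?_ ?_ ?_ hx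
  · intro s
    simp
  · intro x y i _ _ h1 h2
    rw [map_add, h1, h2, smul_add]
  · rintro _ ⟨v, rfl⟩ i x _ h
    rw [map_mul, hθ, h, smul_mul_smul_comm, Nat.succ_eq_add_one, pow_succ']

theorem ExteriorAlgebra.injective_of_scale [Module.Free R M] [IsDomain R]
    (θ : ExteriorAlgebra R M →ₐ[R] ExteriorAlgebra R M) {r : R} (hr : r ≠ 0)
    (hθ : ∀ v, θ (ExteriorAlgebra.ι R v) = r • ExteriorAlgebra.ι R v) :
    Function.Injective θ := by
  rw [injective_iff_map_eq_zero]
  intro x hx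
  have key : ∀ p, extProj R M p (θ x) = r ^ p • extProj R M p x := by
    intro p
    obtain ⟨s, hs⟩ := exists_sum_extProj x
    conv_lhs => rw [hs, map_sum, map_sum]
    conv_rhs => rw [hs, map_sum, Finset.smul_sum]
    refine Finset.sum_congr rfl fun q _ => ?_
    rw [ExteriorAlgebra.algHom_scale θ r hθ (extProj_mem q x), map_smul]
    rcases eq_or_ne q p with rfl | hqp
    · rfl
    · rw [extProj_of_mem_ne (extProj_mem q x) hqp, smul_zero, smul_zero]
  obtain ⟨s, hs⟩ := exists_sum_extProj x
  rw [hs]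
  refine Finset.sum_eq_zero fun p _ => ?_
  have := key p
  rw [hx, map_zero] at this
  exact smul_cancel (pow_ne_zero p hr) (by rw [← this, smul_zero])

end Exterior

section LogForms

/-- The polynomial model of the module of logarithmic forms of all degrees. -/
def logForms (A : Arrangement K ℓ) (m : (Fin ℓ → K) → ℕ) : Submodule (PS K ℓ) (ExtF K ℓ) :=
  ⨅ c ∈ A.hyps, Submodule.comap (LinearMap.mulLeft (PS K ℓ) (dP c))
    (LinearMap.range (LinearMap.lsmul (PS K ℓ) (ExtF K ℓ) (linP c ^ m c)))

theorem mem_logForms {A : Arrangement K ℓ} {m : (Fin ℓ → K) → ℕ} {ζ : ExtF K ℓ} :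
    ζ ∈ logForms A m ↔ ∀ c ∈ A.hyps, ∃ ξ, dP c * ζ = linP c ^ m c • ξ := by
  simp only [logForms, Submodule.mem_iInf, Submodule.mem_comap, LinearMap.mem_range,
    LinearMap.mulLeft_apply, LinearMap.lsmul_apply]
  exact ⟨fun h c hc => (h c hc).imp fun _ => Eq.symm, fun h c hc => (h c hc).imp fun _ => Eq.symm⟩

theorem Omega_eq (A : Arrangement K ℓ) (m : (Fin ℓ → K) → ℕ) (p : ℕ) :
    Omega A m p = formsP K ℓ p ⊓ logForms A m := by
  ext ζ
  simp only [Omega, Submodule.mem_inf, mem_logForms, Submodule.mem_iInf, Submodule.mem_comap,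
    LinearMap.mulLeft_apply, Submodule.mem_map, LinearMap.lsmul_apply]
  refine and_congr_right fun hζ => forall₂_congr fun c _ => ⟨?_, ?_⟩
  · rintro ⟨ξ, -, h⟩
    exact ⟨ξ, h.symm⟩
  · rintro ⟨ξ, h⟩
    refine ⟨extProj _ _ (p + 1) ξ, extProj_mem _ ξ, ?_⟩
    rw [← map_smul, ← h, dP, extProj_ι_mul, extProj_of_mem hζ]

theorem extProj_mem_logForms {A : Arrangement K ℓ} {m : (Fin ℓ → K) → ℕ} {ζ : ExtF K ℓ}
    (hζ : ζ ∈ logForms A m) (p : ℕ) : extProj _ _ p ζ ∈ logForms A m := by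
  rw [mem_logForms] at hζ ⊢
  intro c hc
  obtain ⟨ξ, h⟩ := hζ c hc
  exact ⟨extProj _ _ (p + 1) ξ, by rw [← map_smul, ← h, dP, extProj_ι_mul]⟩

/-- Contraction with the constant vector field `v`. -/
def contr (v : Fin ℓ → K) : ExtF K ℓ →ₗ[PS K ℓ] ExtF K ℓ :=
  CliffordAlgebra.contractLeft (∑ i, (C (v i) : PS K ℓ) • LinearMap.proj i)

theorem contr_ι_mul (v : Fin ℓ → K) (f : Fin ℓ → PS K ℓ) (x : ExtF K ℓ) :
    contr v (ExteriorAlgebra.ι _ f * x) =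
      (∑ i, C (v i) * f i) • x - ExteriorAlgebra.ι _ f * contr v x := by
  have := CliffordAlgebra.contractLeft_ι_mul (Q := (0 : QuadraticForm (PS K ℓ) (Fin ℓ → PS K ℓ)))
    (d := ∑ i, (C (v i) : PS K ℓ) • LinearMap.proj i) f x
  rw [show (∑ i, (C (v i) : PS K ℓ) • (LinearMap.proj i : (Fin ℓ → PS K ℓ) →ₗ[PS K ℓ] PS K ℓ)) f
    = ∑ i, C (v i) * f i by simp] at this
  exact this

theorem contr_dP_mul (v c : Fin ℓ → K) (x : ExtF K ℓ) :
    contr v (dP c * x) = (C (dotLin c v) : PS K ℓ) • x - dP c * contr v x := by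
  rw [dP, contr_ι_mul]
  congr 2
  simp [dotLin, mul_comm]

theorem exists_dotLin_eq_one {c : Fin ℓ → K} (hc : c ≠ 0) : ∃ v, dotLin c v = 1 := by
  obtain ⟨i, hi⟩ := Function.ne_iff.mp hc
  exact ⟨Pi.single i (c i)⁻¹, by simpa [dotLin, Pi.single_apply] using mul_inv_cancel₀ hi⟩

theorem eq_dP_mul_add {c v : Fin ℓ → K} (hv : dotLin c v = 1) {ζ ξ : ExtF K ℓ} {a : PS K ℓ}
    (h : dP c * ζ = a • ξ) : ζ = dP c * contr v ζ + a • contr v ξ := by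
  rw [← map_smul, ← h, contr_dP_mul, hv, C_1, one_smul, add_sub_cancel]

theorem exists_eq_dP_mul_add {c : Fin ℓ → K} (hc : c ≠ 0) {ζ ξ : ExtF K ℓ} {a : PS K ℓ}
    (h : dP c * ζ = a • ξ) : ∃ x y, ζ = dP c * x + a • y := by
  obtain ⟨v, hv⟩ := exists_dotLin_eq_one hc
  exact ⟨_, _, eq_dP_mul_add hv h⟩

theorem mul_right_mem_logForms {A : Arrangement K ℓ} {m : (Fin ℓ → K) → ℕ} {ζ : ExtF K ℓ}
    (hζ : ζ ∈ logForms A m) (x : ExtF K ℓ) : ζ * x ∈ logForms A m := by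
  rw [mem_logForms] at hζ ⊢
  intro c hc
  obtain ⟨ξ, h⟩ := hζ c hc
  exact ⟨ξ * x, by rw [← mul_assoc, h, smul_mul_assoc]⟩

theorem mul_left_mem_logForms {A : Arrangement K ℓ} {m : (Fin ℓ → K) → ℕ} {ζ : ExtF K ℓ}
    (hζ : ζ ∈ logForms A m) (x : ExtF K ℓ) : x * ζ ∈ logForms A m := by
  rw [mem_logForms] at hζ ⊢
  intro c hc
  obtain ⟨ξ, h⟩ := hζ c hc
  refine ⟨CliffordAlgebra.involute x * ξ, ?_⟩
  rw [← mul_assoc, dP, ExteriorAlgebra.ι_mul_eq, mul_assoc, ← dP, h, mul_smul_comm]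

theorem Qpoly_smul_mem_logForms (A : Arrangement K ℓ) (m : (Fin ℓ → K) → ℕ) (x : ExtF K ℓ) :
    Qpoly A m • x ∈ logForms A m := by
  rw [mem_logForms]
  intro c hc
  refine ⟨(∏ d ∈ A.hyps.erase c, linP d ^ m d) • (dP c * x), ?_⟩
  rw [smul_smul, Finset.mul_prod_erase _ (fun d => linP d ^ m d) hc, mul_smul_comm, Qpoly]

theorem prod_erase_smul_dP_mem_logForms {A : Arrangement K ℓ} (m : (Fin ℓ → K) → ℕ)
    {c : Fin ℓ → K} (hc : c ∈ A.hyps) :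
    (∏ d ∈ A.hyps.erase c, linP d ^ m d) • dP c ∈ logForms A m := by
  rw [mem_logForms]
  intro d hd
  rw [mul_smul_comm]
  rcases eq_or_ne d c with rfl | hdc
  · exact ⟨0, by rw [dP, ExteriorAlgebra.ι_sq_zero, smul_zero, smul_zero]⟩
  · refine ⟨(∏ d ∈ (A.hyps.erase c).erase d, linP d ^ m d) • (dP d * dP c), ?_⟩
    rw [smul_smul, Finset.mul_prod_erase _ (fun d => linP d ^ m d)
      (Finset.mem_erase.mpr ⟨hdc, hd⟩)]

theorem exists_eq_Qpoly_smul {F : Type} [AddCommGroup F] [Module (PS K ℓ) F]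
    [Module.Free (PS K ℓ) F] {A : Arrangement K ℓ} {m : (Fin ℓ → K) → ℕ} {x : F}
    (h : ∀ c ∈ A.hyps, ∃ y, x = linP c ^ m c • y) : ∃ y, x = Qpoly A m • y :=
  exists_eq_prod_smul _ _ (A.pairwise_isRelPrime m) x h

/-- Up to the factor `Q`, logarithmic forms are closed under the wedge product. -/
theorem exists_mul_eq_Qpoly_smul {A : Arrangement K ℓ} {m : (Fin ℓ → K) → ℕ} {ζ ζ' : ExtF K ℓ}
    (hζ : ζ ∈ logForms A m) (hζ' : ζ' ∈ logForms A m) :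
    ∃ ξ ∈ logForms A m, ζ * ζ' = Qpoly A m • ξ := by
  rw [mem_logForms] at hζ hζ'
  obtain ⟨ξ, hξ⟩ : ∃ ξ, ζ * ζ' = Qpoly A m • ξ := by
    refine exists_eq_Qpoly_smul fun c hc => ?_
    obtain ⟨_, h⟩ := hζ c hc
    obtain ⟨_, h'⟩ := hζ' c hc
    obtain ⟨x, y, rfl⟩ := exists_eq_dP_mul_add (A.ne_zero c hc) h
    obtain ⟨x', y', rfl⟩ := exists_eq_dP_mul_add (A.ne_zero c hc) h'
    refine ⟨dP c * x * y' + y * (dP c * x' + linP c ^ m c • y'), ?_⟩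
    rw [add_mul, mul_add (dP c * x), ← mul_assoc (dP c * x), dP, ExteriorAlgebra.ι_mul_mul_ι,
      zero_mul, zero_add, mul_smul_comm, smul_add, smul_mul_assoc]
  refine ⟨ξ, mem_logForms.mpr fun c hc => ?_, hξ⟩
  obtain ⟨y, h⟩ := hζ c hc
  obtain ⟨y', h'⟩ := hζ' c hc
  have hdy : ∃ z, y * ζ' = linP c ^ m c • z := by
    obtain ⟨v, hv⟩ := exists_dotLin_eq_one (A.ne_zero c hc)
    have h1 : dP c * y = 0 := by
      refine smul_cancel (pow_ne_zero (m c) (linP_ne_zero (A.ne_zero c hc))) ?_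
      rw [← mul_smul_comm, ← h, dP, ExteriorAlgebra.ι_mul_ι_mul, smul_zero]
    have h2 := eq_dP_mul_add hv (ζ := y) (ξ := 0) (a := 0) (by rw [h1, smul_zero])
    rw [zero_smul, add_zero] at h2
    refine ⟨CliffordAlgebra.involute (contr v y) * y', ?_⟩
    conv_lhs => rw [h2]
    rw [dP, ExteriorAlgebra.ι_mul_eq, mul_assoc, ← dP, h', mul_smul_comm]
  obtain ⟨z, hz⟩ := hdy
  have hrel : IsRelPrime (linP c ^ m c) (∏ d ∈ A.hyps.erase c, linP d ^ m d) :=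
    IsRelPrime.prod_right fun d hd => A.isRelPrime_pow m m hc (Finset.mem_of_mem_erase hd)
      (Finset.ne_of_mem_erase hd).symm
  refine exists_eq_smul_of_isRelPrime hrel (y := z) ?_
  refine smul_cancel (pow_ne_zero (m c) (linP_ne_zero (A.ne_zero c hc))) ?_
  have h3 : linP c ^ m c • (y * ζ') = Qpoly A m • (dP c * ξ) := by
    rw [← smul_mul_assoc, ← h, mul_assoc, hξ, mul_smul_comm]
  rw [smul_smul, Finset.mul_prod_erase _ (fun d => linP d ^ m d) hc, ← hz, h3, Qpoly]

end LogForms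

section Free

theorem exists_eq_ι_of_mem_Omega_one (A : Arrangement K ℓ) (m : (Fin ℓ → K) → ℕ) {x : ExtF K ℓ}
    (hx : x ∈ Omega A m 1) : ∃ v, x = ExteriorAlgebra.ι _ v := by
  have h := hx.1
  rw [formsP, pow_one] at h
  exact h.imp fun _ => Eq.symm

theorem mem_Omega_one {A : Arrangement K ℓ} {m : (Fin ℓ → K) → ℕ} {v : Fin ℓ → PS K ℓ} :
    ExteriorAlgebra.ι _ v ∈ Omega A m 1 ↔ ExteriorAlgebra.ι _ v ∈ logForms A m := by
  rw [Omega_eq, Submodule.mem_inf, and_iff_right]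
  rw [formsP, pow_one]
  exact LinearMap.mem_range_self _ v

/-- Multiplication by `Q`, from the constant-coefficient one-forms to the logarithmic ones. -/
def mulQpoly (A : Arrangement K ℓ) (m : (Fin ℓ → K) → ℕ) :
    (Fin ℓ → PS K ℓ) →ₗ[PS K ℓ] Omega A m 1 :=
  LinearMap.codRestrict _ (Qpoly A m • ExteriorAlgebra.ι _) fun v => by
    rw [LinearMap.smul_apply, ← map_smul, mem_Omega_one, map_smul]
    exact Qpoly_smul_mem_logForms A m _

theorem coe_mulQpoly (A : Arrangement K ℓ) (m : (Fin ℓ → K) → ℕ) (v : Fin ℓ → PS K ℓ) :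
    (mulQpoly A m v : ExtF K ℓ) = Qpoly A m • ExteriorAlgebra.ι _ v := rfl

theorem exists_map_eq_Qpoly_smul {A : Arrangement K ℓ} {m : (Fin ℓ → K) → ℕ}
    [Module.Free (PS K ℓ) (Omega A m 1)] {ζ : ExtF K ℓ} (hζ : ζ ∈ logForms A m) :
    ∃ y, ExteriorAlgebra.map (mulQpoly A m) ζ = Qpoly A m • y := by
  refine exists_eq_Qpoly_smul fun c hc => ?_
  obtain ⟨ξ, h⟩ := mem_logForms.mp hζ c hc
  obtain ⟨x, y, rfl⟩ := exists_eq_dP_mul_add (A.ne_zero c hc) h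
  have hw := prod_erase_smul_dP_mem_logForms m hc
  rw [dP, ← map_smul, ← mem_Omega_one, map_smul] at hw
  have hd : mulQpoly A m (fun i => C (c i)) = linP c ^ m c • ⟨_, hw⟩ := by
    apply Subtype.ext
    rw [coe_mulQpoly, Submodule.coe_smul, smul_smul,
      Finset.mul_prod_erase _ (fun d => linP d ^ m d) hc, Qpoly]
  refine ⟨ExteriorAlgebra.ι _ ⟨_, hw⟩ * ExteriorAlgebra.map (mulQpoly A m) x +
    ExteriorAlgebra.map (mulQpoly A m) y, ?_⟩
  rw [map_add, map_mul, dP, ExteriorAlgebra.map_apply_ι, hd, map_smul, map_smul, smul_add,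
    smul_mul_assoc]

theorem map_mulQpoly_injective (A : Arrangement K ℓ) (m : (Fin ℓ → K) → ℕ) :
    Function.Injective (ExteriorAlgebra.map (mulQpoly A m)) := by
  let Ψ : ExteriorAlgebra (PS K ℓ) (Omega A m 1) →ₐ[PS K ℓ] ExtF K ℓ :=
    ExteriorAlgebra.lift _ ⟨(Omega A m 1).subtype, fun w => by
      obtain ⟨v, hv⟩ := exists_eq_ι_of_mem_Omega_one A m w.2
      rw [Submodule.subtype_apply, hv, ExteriorAlgebra.ι_sq_zero]⟩
  have : Function.Injective (Ψ.comp (ExteriorAlgebra.map (mulQpoly A m))) := by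
    refine ExteriorAlgebra.injective_of_scale _ (Qpoly_ne_zero A m) fun v => ?_
    rw [AlgHom.comp_apply, ExteriorAlgebra.map_apply_ι, ExteriorAlgebra.lift_ι_apply]
    rfl
  exact Function.Injective.of_comp (f := Ψ) this

theorem exists_mem_logForms_map_eq {A : Arrangement K ℓ} {m : (Fin ℓ → K) → ℕ}
    [Module.Free (PS K ℓ) (Omega A m 1)] (y : ExteriorAlgebra (PS K ℓ) (Omega A m 1)) :
    ∃ ζ ∈ logForms A m, ExteriorAlgebra.map (mulQpoly A m) ζ = Qpoly A m • y := by
  induction y using ExteriorAlgebra.induction with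
  | algebraMap r =>
    exact ⟨Qpoly A m • algebraMap _ _ r, Qpoly_smul_mem_logForms A m _, by
      rw [map_smul, AlgHom.commutes]⟩
  | ι w =>
    obtain ⟨v, hv⟩ := exists_eq_ι_of_mem_Omega_one A m w.2
    refine ⟨w, ?_, ?_⟩
    · have := w.2
      rw [hv, mem_Omega_one] at this
      rwa [hv]
    · rw [hv, ExteriorAlgebra.map_apply_ι, ← map_smul]
      congr 1
      apply Subtype.ext
      rw [coe_mulQpoly, ← hv, Submodule.coe_smul]
  | mul x y hx hy =>
    obtain ⟨ζ, hζ, h⟩ := hx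
    obtain ⟨ζ', hζ', h'⟩ := hy
    obtain ⟨ξ, hξ, h2⟩ := exists_mul_eq_Qpoly_smul hζ hζ'
    refine ⟨ξ, hξ, smul_cancel (Qpoly_ne_zero A m) ?_⟩
    rw [← map_smul, ← h2, map_mul, h, h', smul_mul_smul_comm, mul_smul]
  | add x y hx hy =>
    obtain ⟨ζ, hζ, h⟩ := hx
    obtain ⟨ζ', hζ', h'⟩ := hy
    exact ⟨ζ + ζ', add_mem hζ hζ', by rw [map_add, h, h', smul_add]⟩

/-- For a free multiarrangement, the logarithmic forms of all degrees form a free module. -/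
theorem free_logForms {A : Arrangement K ℓ} {m : (Fin ℓ → K) → ℕ} (h : FreeM A m) :
    Module.Free (PS K ℓ) (logForms A m) := by
  have : Module.Free (PS K ℓ) (Omega A m 1) := h
  let Φ := (ExteriorAlgebra.map (mulQpoly A m)).toLinearMap
  have hΦ : Function.Injective Φ := map_mulQpoly_injective A m
  let μ := LinearMap.lsmul (PS K ℓ) (ExteriorAlgebra (PS K ℓ) (Omega A m 1)) (Qpoly A m)
  have hμ : Function.Injective μ := fun x y hxy => smul_cancel (Qpoly_ne_zero A m) hxy
  have heq : (logForms A m).map Φ = LinearMap.range μ := by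
    ext y
    constructor
    · rintro ⟨ζ, hζ, rfl⟩
      obtain ⟨y, hy⟩ := exists_map_eq_Qpoly_smul hζ
      exact ⟨y, hy.symm⟩
    · rintro ⟨y, rfl⟩
      obtain ⟨ζ, hζ, h⟩ := exists_mem_logForms_map_eq y
      exact ⟨ζ, hζ, h⟩
  exact Module.Free.of_equiv ((LinearEquiv.ofInjective μ hμ).trans
    ((LinearEquiv.ofEq _ _ heq.symm).trans (Submodule.equivMapOfInjective Φ hΦ _).symm))

end Free

section Substitution

variable {a b : ℕ}

/-- The linear substitution `X_j ↦ ∑ i, Λ j i * X_i`. -/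
def linSubst (Λ : Fin a → Fin b → K) : PS K a →ₐ[K] PS K b := aeval fun j => linP (Λ j)

theorem linSubst_linP (Λ : Fin a → Fin b → K) (c : Fin a → K) :
    linSubst Λ (linP c) = linP fun i => ∑ j, c j * Λ j i := by
  have : (fun i => ∑ j, c j * Λ j i) = ∑ j, c j • Λ j := by
    ext i
    simp
  rw [this, linP, map_sum]
  simp only [map_mul, linSubst, aeval_X, algHom_C, algebraMap_eq]
  simp only [linP, Finset.sum_apply, Pi.smul_apply, smul_eq_mul, map_sum, map_mul, Finset.mul_sum,
    Finset.sum_mul]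
  rw [Finset.sum_comm]
  exact Finset.sum_congr rfl fun _ _ => Finset.sum_congr rfl fun _ _ => by ring

theorem linSubst_isHomogeneous (Λ : Fin a → Fin b → K) {f : PS K a} {d : ℕ}
    (hf : f.IsHomogeneous d) : (linSubst Λ f).IsHomogeneous d := by
  have := hf.aeval (fun j => linP (Λ j)) fun j => linP_isHomogeneous (Λ j)
  simpa [linSubst] using this

/-- The linear substitution on one-forms. -/
def formSubst (Λ : Fin a → Fin b → K) (v : Fin a → PS K a) : Fin b → PS K b :=
  fun i => ∑ j, C (Λ j i) * linSubst Λ (v j)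

theorem formSubst_add (Λ : Fin a → Fin b → K) (v w : Fin a → PS K a) :
    formSubst Λ (v + w) = formSubst Λ v + formSubst Λ w := by
  ext1 i
  simp [formSubst, mul_add, Finset.sum_add_distrib]

theorem formSubst_smul (Λ : Fin a → Fin b → K) (s : PS K a) (v : Fin a → PS K a) :
    formSubst Λ (s • v) = linSubst Λ s • formSubst Λ v := by
  ext1 i
  simp [formSubst, Finset.mul_sum, mul_left_comm]

/-- The linear substitution on polynomial differential forms. -/
def extSubst (Λ : Fin a → Fin b → K) : ExtF K a →+* ExtF K b :=
  letI : Algebra (PS K a) (ExtF K b) := Algebra.compHom (ExtF K b) (linSubst Λ).toRingHom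
  (ExteriorAlgebra.lift (PS K a) (A := ExtF K b)
    ⟨{ toFun := fun v => ExteriorAlgebra.ι (PS K b) (formSubst Λ v)
       map_add' := fun v w => by rw [formSubst_add, map_add]
       map_smul' := fun s v => by
        rw [formSubst_smul, map_smul]
        rfl }, fun v => ExteriorAlgebra.ι_sq_zero _⟩).toRingHom

theorem extSubst_ι (Λ : Fin a → Fin b → K) (v : Fin a → PS K a) :
    extSubst Λ (ExteriorAlgebra.ι _ v) = ExteriorAlgebra.ι _ (formSubst Λ v) := by
  let _ : Algebra (PS K a) (ExtF K b) := Algebra.compHom (ExtF K b) (linSubst Λ).toRingHom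
  exact ExteriorAlgebra.lift_ι_apply (A := ExtF K b) (PS K a) _ _ v

theorem extSubst_algebraMap (Λ : Fin a → Fin b → K) (s : PS K a) :
    extSubst Λ (algebraMap _ _ s) = algebraMap _ _ (linSubst Λ s) := by
  let _ : Algebra (PS K a) (ExtF K b) := Algebra.compHom (ExtF K b) (linSubst Λ).toRingHom
  exact AlgHom.commutes (ExteriorAlgebra.lift (PS K a) (A := ExtF K b) _) s

theorem extSubst_smul (Λ : Fin a → Fin b → K) (s : PS K a) (x : ExtF K a) :
    extSubst Λ (s • x) = linSubst Λ s • extSubst Λ x := by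
  rw [Algebra.smul_def, map_mul, extSubst_algebraMap, ← Algebra.smul_def]

theorem extSubst_dP (Λ : Fin a → Fin b → K) (c : Fin a → K) :
    extSubst Λ (dP c) = dP fun i => ∑ j, c j * Λ j i := by
  rw [dP, extSubst_ι, dP]
  congr 1
  ext1 i
  simp only [formSubst, algHom_C, algebraMap_eq, map_sum, map_mul]
  exact Finset.sum_congr rfl fun _ _ => mul_comm _ _

theorem dP_add (c d : Fin ℓ → K) : dP (c + d) = dP c + dP d := by
  rw [dP, dP, dP, ← map_add]
  congr 1
  ext1 i
  simp

theorem dP_smul (t : K) (c : Fin ℓ → K) : dP (t • c) = (C t : PS K ℓ) • dP c := by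
  rw [dP, dP, ← map_smul]
  congr 1
  ext1 i
  simp

/-- Polynomial differential forms are generated as a ring by constants, `x_j` and `dx_j`. -/
theorem ExtF.induction {P : ExtF K ℓ → Prop} (hC : ∀ t, P (algebraMap (PS K ℓ) _ (C t)))
    (hX : ∀ j, P (algebraMap (PS K ℓ) _ (X j))) (hd : ∀ j, P (dP (Pi.single j 1)))
    (hadd : ∀ x y, P x → P y → P (x + y)) (hmul : ∀ x y, P x → P y → P (x * y)) (x : ExtF K ℓ) :
    P x := by
  have hS : ∀ s, P (algebraMap (PS K ℓ) _ s) := by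
    intro s
    induction s using MvPolynomial.induction_on with
    | C t => exact hC t
    | add p q hp hq => rw [map_add]; exact hadd _ _ hp hq
    | mul_X p j hp => rw [map_mul]; exact hmul _ _ hp (hX j)
  induction x using ExteriorAlgebra.induction with
  | algebraMap r => exact hS r
  | ι v =>
    have : ∀ s : Finset (Fin ℓ), P (∑ j ∈ s, v j • dP (Pi.single j 1)) := by
      intro s
      induction s using Finset.induction_on with
      | empty => simpa using hS 0
      | insert j s hj ih =>
        rw [Finset.sum_insert hj]
        refine hadd _ _ ?_ ih
        rw [Algebra.smul_def]
        exact hmul _ _ (hS _) (hd j)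
    have h2 := this Finset.univ
    have h3 : ∑ j, v j • dP (Pi.single j (1 : K)) = ExteriorAlgebra.ι _ v := by
      simp only [dP, ← map_smul, ← map_sum]
      congr 1
      ext1 i
      simp [Finset.sum_apply, Pi.single_apply, apply_ite C]
    rwa [h3] at h2
  | mul x y hx hy => exact hmul x y hx hy
  | add x y hx hy => exact hadd x y hx hy

end Substitution

section Restriction

/-- A splitting of the embedding `e` of the hyperplane `ker c0`: a vector `v` with `c0 v = 1` and
the preimages `w j` of the projections of the standard basis vectors to the hyperplane. -/
structure HypSplitting (c0 : Fin ℓ → K) (e : (Fin (ℓ - 1) → K) →ₗ[K] (Fin ℓ → K)) : Type where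
  v : Fin ℓ → K
  w : Fin ℓ → Fin (ℓ - 1) → K
  dot_v : dotLin c0 v = 1
  e_w : ∀ j, e (w j) = Pi.single j 1 - c0 j • v
  dot_e : ∀ u, dotLin c0 (e u) = 0
  inj : Function.Injective e

theorem dotLin_apply (c x : Fin ℓ → K) : dotLin c x = ∑ i, c i * x i := by
  simp [dotLin]

theorem IsHypEmbedding.exists_splitting {c0 : Fin ℓ → K}
    {e : (Fin (ℓ - 1) → K) →ₗ[K] (Fin ℓ → K)} (he : IsHypEmbedding c0 e) {v : Fin ℓ → K}
    (hv : dotLin c0 v = 1) : ∃ D : HypSplitting c0 e, D.v = v := by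
  have h : ∀ j, ∃ w, e w = Pi.single j 1 - c0 j • v := by
    intro j
    rw [← LinearMap.mem_range, he.2, LinearMap.mem_ker, map_sub, map_smul, hv]
    simp [dotLin_apply, Pi.single_apply]
  choose w hw using h
  exact ⟨⟨v, w, hv, hw, fun u => LinearMap.mem_ker.mp (he.2 ▸ LinearMap.mem_range_self e u), he.1⟩,
    rfl⟩

variable {c0 : Fin ℓ → K} {e : (Fin (ℓ - 1) → K) →ₗ[K] (Fin ℓ → K)}

/-- Restriction of polynomials to the hyperplane. -/
def resP (e : (Fin (ℓ - 1) → K) →ₗ[K] (Fin ℓ → K)) : PS K ℓ →ₐ[K] PS K (ℓ - 1) :=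
  linSubst fun j i => e (Pi.single i 1) j

/-- Restriction of polynomial differential forms to the hyperplane. -/
def resE (e : (Fin (ℓ - 1) → K) →ₗ[K] (Fin ℓ → K)) : ExtF K ℓ →+* ExtF K (ℓ - 1) :=
  extSubst fun j i => e (Pi.single i 1) j

theorem resP_linP (c : Fin ℓ → K) : resP e (linP c) = linP (restrictForm e c) :=
  linSubst_linP _ c

theorem resE_dP (c : Fin ℓ → K) : resE e (dP c) = dP (restrictForm e c) :=
  extSubst_dP _ c

theorem resE_smul (s : PS K ℓ) (x : ExtF K ℓ) : resE e (s • x) = resP e s • resE e x :=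
  extSubst_smul _ s x

theorem resE_algebraMap (s : PS K ℓ) : resE e (algebraMap _ _ s) = algebraMap _ _ (resP e s) :=
  extSubst_algebraMap _ s

theorem linP_zero : linP (0 : Fin ℓ → K) = 0 := by simp [linP]

theorem dP_zero : dP (0 : Fin ℓ → K) = 0 := by
  have := dP_smul (0 : K) (0 : Fin ℓ → K)
  rwa [C_0, zero_smul, zero_smul] at this

theorem e_apply (u : Fin (ℓ - 1) → K) (j : Fin ℓ) : e u j = ∑ i, u i * e (Pi.single i 1) j := by
  conv_lhs => rw [pi_eq_sum_univ' u]
  simp [map_sum, Finset.sum_apply]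

theorem sum_restrictForm_mul (u : Fin ℓ → K) (x : Fin (ℓ - 1) → K) :
    ∑ i, restrictForm e u i * x i = dotLin u (e x) := by
  simp only [restrictForm, dotLin_apply, e_apply x, Finset.mul_sum, Finset.sum_mul]
  rw [Finset.sum_comm]
  exact Finset.sum_congr rfl fun _ _ => Finset.sum_congr rfl fun _ _ => by ring

namespace HypSplitting

theorem ne_zero (D : HypSplitting c0 e) : c0 ≠ 0 := by
  rintro rfl
  have := D.dot_v
  simp [dotLin] at this

theorem restrictForm_self (D : HypSplitting c0 e) : restrictForm e c0 = 0 := by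
  ext i
  have := D.dot_e (Pi.single i 1)
  rwa [dotLin_apply] at this

theorem resP_self (D : HypSplitting c0 e) : resP e (linP c0) = 0 := by
  rw [resP_linP, D.restrictForm_self, linP_zero]

theorem resE_self (D : HypSplitting c0 e) : resE e (dP c0) = 0 := by
  rw [resE_dP, D.restrictForm_self, dP_zero]

theorem eq_smul_of_restrictForm_eq_zero (D : HypSplitting c0 e) {u : Fin ℓ → K}
    (hu : restrictForm e u = 0) : u = dotLin u D.v • c0 := by
  ext j
  have h := sum_restrictForm_mul (e := e) u (D.w j)
  rw [hu, D.e_w, map_sub, map_smul] at h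
  have h2 : dotLin u (Pi.single j 1) = u j := by simp [dotLin_apply, Pi.single_apply]
  rw [h2] at h
  simp only [Pi.zero_apply, zero_mul, Finset.sum_const_zero, smul_eq_mul] at h
  rw [Pi.smul_apply, smul_eq_mul, mul_comm]
  exact sub_eq_zero.mp h.symm

/-- Extension of polynomials from the hyperplane along the splitting. -/
def liftP (D : HypSplitting c0 e) : PS K (ℓ - 1) →ₐ[K] PS K ℓ := linSubst fun i j => D.w j i

/-- Extension of forms from the hyperplane along the splitting. -/
def liftE (D : HypSplitting c0 e) : ExtF K (ℓ - 1) →+* ExtF K ℓ := extSubst fun i j => D.w j i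

theorem sum_w (D : HypSplitting c0 e) (i k : Fin (ℓ - 1)) :
    ∑ j, D.w j i * e (Pi.single k 1) j = (Pi.single i 1 : Fin (ℓ - 1) → K) k := by
  have h : ∑ j, e (Pi.single k 1) j • D.w j = Pi.single k 1 := by
    apply D.inj
    rw [map_sum]
    simp only [map_smul, D.e_w, smul_sub, Finset.sum_sub_distrib, smul_smul, ← Finset.sum_smul]
    have : ∑ j, e (Pi.single k 1) j * c0 j = 0 := by
      rw [← D.dot_e (Pi.single k 1), dotLin_apply]
      exact Finset.sum_congr rfl fun _ _ => mul_comm _ _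
    rw [this, zero_smul, sub_zero, ← pi_eq_sum_univ']
  have h2 := congrFun h i
  simp only [Finset.sum_apply, Pi.smul_apply, smul_eq_mul] at h2
  rw [← Pi.single_comm, ← h2]
  exact Finset.sum_congr rfl fun _ _ => mul_comm _ _

theorem sum_e_w (D : HypSplitting c0 e) (j k : Fin ℓ) :
    ∑ i, e (Pi.single i 1) j * D.w k i = ((Pi.single j 1 : Fin ℓ → K) - D.v j • c0) k := by
  have h := congrFun (D.e_w k) j
  rw [e_apply] at h
  simp only [mul_comm (D.w k _)] at h
  rw [h, Pi.sub_apply, Pi.sub_apply, Pi.single_comm]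
  simp [mul_comm]

theorem resE_liftE (D : HypSplitting c0 e) (x : ExtF K (ℓ - 1)) : resE e (D.liftE x) = x := by
  induction x using ExtF.induction with
  | hC t => simp [liftE, resE, extSubst_algebraMap]
  | hX i =>
    rw [liftE, resE, extSubst_algebraMap, extSubst_algebraMap, ← linP_single, linSubst_linP,
      linSubst_linP]
    congr 2
    ext k
    simp [Pi.single_apply, D.sum_w, eq_comm]
  | hd i =>
    rw [liftE, resE, extSubst_dP, extSubst_dP]
    congr 1
    ext k
    simp [Pi.single_apply, D.sum_w, eq_comm]
  | hadd x y hx hy => rw [map_add, map_add, hx, hy]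
  | hmul x y hx hy => rw [map_mul, map_mul, hx, hy]

theorem resP_liftP (D : HypSplitting c0 e) (s : PS K (ℓ - 1)) : resP e (D.liftP s) = s := by
  have := D.resE_liftE (algebraMap _ _ s)
  rw [liftE, extSubst_algebraMap, resE_algebraMap] at this
  exact ExteriorAlgebra.algebraMap_leftInverse _ |>.injective this

theorem resP_surjective (D : HypSplitting c0 e) : Function.Surjective (resP e) :=
  fun s => ⟨_, D.resP_liftP s⟩

/-- The arrangement consisting of the single hyperplane. -/
def arr (D : HypSplitting c0 e) : Arrangement K ℓ where
  hyps := {c0}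
  ne_zero := fun c hc => by
    rw [Finset.mem_singleton.mp hc]
    exact D.ne_zero
  nonprop := fun c hc c' hc' h => by
    rw [Finset.mem_singleton.mp hc, Finset.mem_singleton.mp hc'] at h
    exact absurd rfl h

theorem mem_arr (D : HypSplitting c0 e) {x : ExtF K ℓ} :
    x ∈ logForms D.arr (fun _ => 1) ↔ ∃ y, dP c0 * x = linP c0 • y := by
  simp [mem_logForms, arr]

theorem self_smul_mem (D : HypSplitting c0 e) (x : ExtF K ℓ) :
    linP c0 • x ∈ logForms D.arr (fun _ => 1) :=
  D.mem_arr.mpr ⟨dP c0 * x, mul_smul_comm _ _ _⟩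

theorem liftE_resE_sub_mem (D : HypSplitting c0 e) (x : ExtF K ℓ) :
    D.liftE (resE e x) - x ∈ logForms D.arr (fun _ => 1) := by
  induction x using ExtF.induction with
  | hC t => simp [liftE, resE, extSubst_algebraMap]
  | hX j =>
    rw [liftE, resE, extSubst_algebraMap, extSubst_algebraMap, ← linP_single, linSubst_linP,
      linSubst_linP]
    have : (fun k => ∑ i,
        (∑ l, (Pi.single j (1 : K) : Fin ℓ → K) l * e (Pi.single i 1) l) * D.w k i) =
        Pi.single j 1 + (- D.v j) • c0 := by
      ext k
      rw [neg_smul, ← sub_eq_add_neg, ← D.sum_e_w]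
      simp [Pi.single_apply]
    rw [this, linP_add, linP_smul, map_add, add_sub_cancel_left, mul_comm, map_mul,
      ← Algebra.smul_def]
    exact D.self_smul_mem _
  | hd j =>
    rw [liftE, resE, extSubst_dP, extSubst_dP]
    have : (fun k => ∑ i,
        (∑ l, (Pi.single j (1 : K) : Fin ℓ → K) l * e (Pi.single i 1) l) * D.w k i) =
        Pi.single j 1 + (- D.v j) • c0 := by
      ext k
      rw [neg_smul, ← sub_eq_add_neg, ← D.sum_e_w]
      simp [Pi.single_apply]
    rw [this, dP_add, add_sub_cancel_left, dP_smul]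
    exact D.mem_arr.mpr ⟨0, by
      rw [mul_smul_comm, dP, ExteriorAlgebra.ι_sq_zero, smul_zero, smul_zero]⟩
  | hadd x y hx hy =>
    rw [map_add, map_add, add_sub_add_comm]
    exact add_mem hx hy
  | hmul x y hx hy =>
    have : D.liftE (resE e (x * y)) - x * y =
        (D.liftE (resE e x) - x) * D.liftE (resE e y) + x * (D.liftE (resE e y) - y) := by
      rw [map_mul, map_mul]
      noncomm_ring
    rw [this]
    exact add_mem (mul_right_mem_logForms hx _) (mul_left_mem_logForms hy _)

theorem resE_eq_zero_iff (D : HypSplitting c0 e) {x : ExtF K ℓ} :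
    resE e x = 0 ↔ ∃ y, dP c0 * x = linP c0 • y := by
  constructor
  · intro h
    have := D.liftE_resE_sub_mem x
    rw [h, map_zero, zero_sub, neg_mem_iff] at this
    exact D.mem_arr.mp this
  · rintro ⟨y, hy⟩
    obtain ⟨u, w, rfl⟩ := exists_eq_dP_mul_add D.ne_zero hy
    rw [map_add, map_mul, resE_smul, D.resE_self, D.resP_self, zero_mul, zero_smul, add_zero]

theorem dvd_of_resP_eq_zero (D : HypSplitting c0 e) {s : PS K ℓ} (hs : resP e s = 0) :
    linP c0 ∣ s := by
  have h : resE e (s • 1) = 0 := by rw [resE_smul, hs, zero_smul]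
  obtain ⟨y, hy⟩ := D.resE_eq_zero_iff.mp h
  have h2 := congrArg (contr D.v) hy
  rw [contr_dP_mul, D.dot_v, C_1, one_smul, map_smul, map_smul] at h2
  have h3 : contr D.v 1 = 0 := CliffordAlgebra.contractLeft_one _ _
  rw [h3, smul_zero, mul_zero, sub_zero] at h2
  have h4 := congrArg (ExteriorAlgebra.algebraMapInv) h2
  rw [map_smul, map_smul, map_one, smul_eq_mul, mul_one] at h4
  exact ⟨_, h4⟩

theorem resP_eq_zero_iff (D : HypSplitting c0 e) {s : PS K ℓ} : resP e s = 0 ↔ linP c0 ∣ s :=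
  ⟨D.dvd_of_resP_eq_zero, by rintro ⟨q, rfl⟩; rw [map_mul, D.resP_self, zero_mul]⟩

end HypSplitting

end Restriction

section Gcd

theorem Ideal.eq_top_of_forall_prime {R : Type} [CommRing R] [IsDomain R]
    [UniqueFactorizationMonoid R] (J : Ideal R)
    (hJ : ∀ h f g, f ≠ 0 → IsRelPrime f g → h * f ∈ J → h * g ∈ J → h ∈ J) {a : R} (ha : a ≠ 0)
    (haJ : a ∈ J) (hp : ∀ p, Prime p → p ∣ a → ∃ g ∈ J, ¬ p ∣ g) : J = ⊤ := by
  have hwf : WellFounded (DvdNotUnit : R → R → Prop) := wellFounded_dvdNotUnit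
  obtain ⟨f, ⟨hf0, hfJ, hfa⟩, hmin⟩ :=
    hwf.has_min {f | f ≠ 0 ∧ f ∈ J ∧ f ∣ a} ⟨a, ha, haJ, dvd_rfl⟩
  by_cases hu : IsUnit f
  · exact J.eq_top_of_isUnit_mem hfJ hu
  obtain ⟨p, hpi, hpf⟩ := WfDvdMonoid.exists_irreducible_factor hu hf0
  obtain ⟨g, hgJ, hpg⟩ := hp p hpi.prime (hpf.trans hfa)
  obtain ⟨f', g', h, hrel, rfl, rfl⟩ := UniqueFactorizationMonoid.exists_reduced_factors f hf0 g
  have hh : h ∈ J := hJ h f' g' (right_ne_zero_of_mul hf0) hrel hfJ hgJ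
  refine absurd ?_ (hmin h ⟨left_ne_zero_of_mul hf0, hh, (dvd_mul_right h f').trans hfa⟩)
  refine ⟨left_ne_zero_of_mul hf0, f', fun hf' => hpg ?_, rfl⟩
  obtain ⟨u, rfl⟩ := hf'
  exact (hpi.prime.dvd_or_dvd hpf).elim (fun h1 => h1.mul_right _)
    fun h1 => absurd (isUnit_of_dvd_unit h1 u.isUnit) hpi.not_isUnit

end Gcd

section Residue

variable {c0 : Fin ℓ → K} {e : (Fin (ℓ - 1) → K) →ₗ[K] (Fin ℓ → K)}

/-- `τ` is the residue of `ζ` along the hyperplane, relative to the pole order `n`. -/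
def IsRes (c0 : Fin ℓ → K) (e : (Fin (ℓ - 1) → K) →ₗ[K] (Fin ℓ → K)) (n : ℕ) (ζ : ExtF K ℓ)
    (τ : ExtF K (ℓ - 1)) : Prop :=
  ∃ μ η, ζ = dP c0 * μ + linP c0 ^ n • η ∧ resE e η = τ

namespace IsRes

variable {n : ℕ} {ζ ζ' : ExtF K ℓ} {τ τ' : ExtF K (ℓ - 1)}

theorem add (h : IsRes c0 e n ζ τ) (h' : IsRes c0 e n ζ' τ') :
    IsRes c0 e n (ζ + ζ') (τ + τ') := by
  obtain ⟨μ, η, rfl, rfl⟩ := h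
  obtain ⟨μ', η', rfl, rfl⟩ := h'
  exact ⟨μ + μ', η + η', by rw [mul_add, smul_add, add_add_add_comm], map_add _ _ _⟩

theorem smul (s : PS K ℓ) (h : IsRes c0 e n ζ τ) : IsRes c0 e n (s • ζ) (resP e s • τ) := by
  obtain ⟨μ, η, rfl, rfl⟩ := h
  exact ⟨s • μ, s • η, by rw [smul_add, mul_smul_comm, smul_comm s], resE_smul _ _⟩

theorem neg (h : IsRes c0 e n ζ τ) : IsRes c0 e n (-ζ) (-τ) := by
  simpa using h.smul (-1)

theorem sub (h : IsRes c0 e n ζ τ) (h' : IsRes c0 e n ζ' τ') :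
    IsRes c0 e n (ζ - ζ') (τ - τ') := by
  rw [sub_eq_add_neg, sub_eq_add_neg]
  exact h.add h'.neg

theorem mul_right (h : IsRes c0 e n ζ τ) (x : ExtF K ℓ) :
    IsRes c0 e n (ζ * x) (τ * resE e x) := by
  obtain ⟨μ, η, rfl, rfl⟩ := h
  exact ⟨μ * x, η * x, by rw [add_mul, mul_assoc, smul_mul_assoc], map_mul _ _ _⟩

theorem zero : IsRes c0 e n 0 0 := ⟨0, 0, by simp, map_zero _⟩

theorem eq_zero (D : HypSplitting c0 e) (h : IsRes c0 e n 0 τ) : τ = 0 := by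
  obtain ⟨μ, η, h, rfl⟩ := h
  have h1 := congrArg (dP c0 * ·) h
  simp only [mul_zero, mul_add, mul_smul_comm] at h1
  rw [dP, ExteriorAlgebra.ι_mul_ι_mul, zero_add, ← dP] at h1
  refine D.resE_eq_zero_iff.mpr ⟨0, ?_⟩
  rw [smul_zero]
  exact smul_cancel (pow_ne_zero n (linP_ne_zero D.ne_zero)) (by rw [← h1, smul_zero])

theorem unique (D : HypSplitting c0 e) (h : IsRes c0 e n ζ τ) (h' : IsRes c0 e n ζ τ') :
    τ = τ' := by
  have := h.sub h'
  rw [sub_self] at this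
  exact sub_eq_zero.mp (this.eq_zero D)

end IsRes

variable {A : Arrangement K ℓ} {m : (Fin ℓ → K) → ℕ}

theorem mdel_self (m : (Fin ℓ → K) → ℕ) (c0 : Fin ℓ → K) : mdel m c0 c0 = m c0 - 1 := if_pos rfl

theorem mdel_of_ne (m : (Fin ℓ → K) → ℕ) {c0 c : Fin ℓ → K} (h : c ≠ c0) : mdel m c0 c = m c :=
  if_neg h

theorem exists_isRes (hc0 : c0 ∈ A.hyps) {ζ : ExtF K ℓ} (hζ : ζ ∈ logForms A (mdel m c0)) :
    ∃ τ, IsRes c0 e (m c0 - 1) ζ τ := by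
  obtain ⟨ξ, h⟩ := mem_logForms.mp hζ c0 hc0
  obtain ⟨μ, η, rfl⟩ := exists_eq_dP_mul_add (A.ne_zero c0 hc0) h
  exact ⟨_, μ, η, by rw [mdel_self], rfl⟩

theorem logForms_le_mdel (A : Arrangement K ℓ) (m : (Fin ℓ → K) → ℕ) (c0 : Fin ℓ → K) :
    logForms A m ≤ logForms A (mdel m c0) := by
  intro ζ hζ
  rw [mem_logForms] at hζ ⊢
  intro c hc
  obtain ⟨ξ, h⟩ := hζ c hc
  have hle : mdel m c0 c ≤ m c := by
    rw [mdel]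
    split_ifs <;> omega
  exact ⟨linP c ^ (m c - mdel m c0 c) • ξ, by rw [smul_smul, ← pow_add, Nat.add_sub_cancel' hle, h]⟩

theorem linP_smul_mem_iff (hc0 : c0 ∈ A.hyps) (hm : 0 < m c0) {ζ : ExtF K ℓ} :
    linP c0 • ζ ∈ logForms A m ↔ ζ ∈ logForms A (mdel m c0) := by
  rw [mem_logForms, mem_logForms]
  refine forall₂_congr fun c hc => ?_
  rw [mul_smul_comm]
  rcases eq_or_ne c c0 with rfl | hne
  · rw [mdel_self]
    have hpow : linP c ^ m c = linP c * linP c ^ (m c - 1) := by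
      rw [← pow_succ', Nat.sub_add_cancel hm]
    constructor
    · rintro ⟨ξ, h⟩
      exact ⟨ξ, smul_cancel (linP_ne_zero (A.ne_zero c hc)) (by rw [h, smul_smul, hpow])⟩
    · rintro ⟨ξ, h⟩
      exact ⟨ξ, by rw [h, smul_smul, hpow]⟩
  · rw [mdel_of_ne m hne]
    constructor
    · rintro ⟨ξ, h⟩
      refine exists_eq_smul_of_isRelPrime (F := ExtF K ℓ) (R := PS K ℓ) (c := linP c0) (y := ξ) ?_ h
      simpa using A.isRelPrime_pow m (fun _ => 1) hc hc0 hne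
    · rintro ⟨ξ, h⟩
      exact ⟨linP c0 • ξ, by rw [h, smul_comm]⟩

theorem isRes_zero_iff (D : HypSplitting c0 e) (hc0 : c0 ∈ A.hyps) (hm : 0 < m c0) {ζ : ExtF K ℓ}
    (hζ : ζ ∈ logForms A (mdel m c0)) : IsRes c0 e (m c0 - 1) ζ 0 ↔ ζ ∈ logForms A m := by
  have hpow : linP c0 ^ m c0 = linP c0 ^ (m c0 - 1) * linP c0 := by
    rw [← pow_succ, Nat.sub_add_cancel hm]
  constructor
  · rintro ⟨μ, η, h, hη⟩
    rw [mem_logForms] at hζ ⊢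
    intro c hc
    rcases eq_or_ne c c0 with rfl | hne
    · obtain ⟨y, hy⟩ := D.resE_eq_zero_iff.mp hη
      refine ⟨y, ?_⟩
      rw [h, mul_add, dP, ExteriorAlgebra.ι_mul_ι_mul, zero_add, ← dP, mul_smul_comm, hy, smul_smul,
        hpow]
    · obtain ⟨ξ, h⟩ := hζ c hc
      rw [mdel_of_ne m hne] at h
      exact ⟨ξ, h⟩
  · intro h
    obtain ⟨ξ, h⟩ := mem_logForms.mp h c0 hc0
    obtain ⟨μ, η, rfl⟩ := exists_eq_dP_mul_add (A.ne_zero c0 hc0) h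
    exact ⟨μ, linP c0 • η, by rw [smul_smul, hpow], by rw [resE_smul, D.resP_self, zero_smul]⟩

/-- The module of residues of logarithmic forms of `(A, m - δ_H)` along `H`. -/
def residues (D : HypSplitting c0 e) (A : Arrangement K ℓ) (m : (Fin ℓ → K) → ℕ) :
    Submodule (PS K (ℓ - 1)) (ExtF K (ℓ - 1)) where
  carrier := {τ | ∃ ζ ∈ logForms A (mdel m c0), IsRes c0 e (m c0 - 1) ζ τ}
  zero_mem' := ⟨0, zero_mem _, IsRes.zero⟩
  add_mem' := by
    rintro _ _ ⟨ζ, hζ, h⟩ ⟨ζ', hζ', h'⟩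
    exact ⟨ζ + ζ', add_mem hζ hζ', h.add h'⟩
  smul_mem' := by
    rintro s _ ⟨ζ, hζ, h⟩
    obtain ⟨s, rfl⟩ := D.resP_surjective s
    exact ⟨s • ζ, Submodule.smul_mem _ _ hζ, h.smul s⟩

theorem mem_residues {D : HypSplitting c0 e} {τ : ExtF K (ℓ - 1)} :
    τ ∈ residues D A m ↔ ∃ ζ ∈ logForms A (mdel m c0), IsRes c0 e (m c0 - 1) ζ τ := Iff.rfl

theorem mem_residues_of_isRelPrime (D : HypSplitting c0 e) (hc0 : c0 ∈ A.hyps) (hm : 0 < m c0)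
    (hfree : Module.Free (PS K ℓ) (logForms A m)) {f g : PS K (ℓ - 1)} (hf : f ≠ 0)
    (hfg : IsRelPrime f g) {τ : ExtF K (ℓ - 1)} (h1 : f • τ ∈ residues D A m)
    (h2 : g • τ ∈ residues D A m) : τ ∈ residues D A m := by
  obtain ⟨f, rfl⟩ := D.resP_surjective f
  obtain ⟨g, rfl⟩ := D.resP_surjective g
  obtain ⟨η1, hη1, r1⟩ := h1
  obtain ⟨η2, hη2, r2⟩ := h2
  have hw : g • η1 - f • η2 ∈ logForms A m := by
    rw [← isRes_zero_iff D hc0 hm (sub_mem (Submodule.smul_mem _ _ hη1)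
      (Submodule.smul_mem _ _ hη2))]
    have := (r1.smul g).sub (r2.smul f)
    rwa [smul_smul, smul_smul, mul_comm, sub_self] at this
  obtain ⟨y, z, hyz⟩ := exists_eq_smul_add_smul (F := logForms A m) (resP e).toRingHom
    D.resP_surjective (fun _ hs => D.dvd_of_resP_eq_zero hs) D.resP_self (f := g) (g := f) hfg
    (u := ⟨_, (linP_smul_mem_iff hc0 hm).mpr hη1⟩) (v := ⟨_, (linP_smul_mem_iff hc0 hm).mpr hη2⟩)
    (w := ⟨_, hw⟩) (by
      apply Subtype.ext
      simp only [Submodule.coe_smul, Submodule.coe_add, smul_sub, smul_comm (linP c0)]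
      abel)
  have hyz' := congrArg Subtype.val hyz
  simp only [Submodule.coe_smul, Submodule.coe_add] at hyz'
  have hrel : IsRelPrime (linP c0) f := by
    rw [(linP_prime (A.ne_zero c0 hc0)).irreducible.isRelPrime_iff_not_dvd, ← D.resP_eq_zero_iff]
    exact hf
  obtain ⟨y', hy'⟩ := exists_eq_smul_of_isRelPrime hrel (x := (y : ExtF K ℓ))
    (y := η1 - (z : ExtF K ℓ)) (by rw [smul_sub, hyz', add_sub_cancel_right])
  have hy'm : y' ∈ logForms A (mdel m c0) := by
    rw [← linP_smul_mem_iff hc0 hm, ← hy']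
    exact y.2
  obtain ⟨τ', hτ'⟩ := exists_isRes (e := e) hc0 hy'm
  have h3 : f • y' = η1 - z := by
    refine smul_cancel (linP_ne_zero (A.ne_zero c0 hc0)) ?_
    rw [smul_comm, ← hy', smul_sub, hyz', add_sub_cancel_right]
  have h4 := r1.sub ((isRes_zero_iff D hc0 hm (logForms_le_mdel A m c0 z.2)).mpr z.2)
  rw [← h3, sub_zero] at h4
  have h5 := smul_cancel hf ((hτ'.smul f).unique D h4)
  exact ⟨y', hy'm, h5 ▸ hτ'⟩

/-- The colon ideal criterion for being a residue. -/
theorem mem_residues_of_forall_prime (D : HypSplitting c0 e) (hc0 : c0 ∈ A.hyps) (hm : 0 < m c0)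
    (hfree : Module.Free (PS K ℓ) (logForms A m)) {τ : ExtF K (ℓ - 1)} {a : PS K (ℓ - 1)}
    (ha : a ≠ 0) (haτ : a • τ ∈ residues D A m)
    (hp : ∀ p, Prime p → p ∣ a → ∃ g, g • τ ∈ residues D A m ∧ ¬ p ∣ g) :
    τ ∈ residues D A m := by
  let J : Ideal (PS K (ℓ - 1)) := (residues D A m).comap (LinearMap.toSpanSingleton _ _ τ)
  have hJ : ∀ g, g ∈ J ↔ g • τ ∈ residues D A m := fun g => by
    simp [J, LinearMap.toSpanSingleton_apply]
  have := Ideal.eq_top_of_forall_prime J (fun h f g hf hfg h1 h2 => ?_) ha ((hJ a).mpr haτ)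
    (fun p h1 h2 => ?_)
  · have h1 := (hJ 1).mp (this ▸ Submodule.mem_top)
    rwa [one_smul] at h1
  · rw [hJ] at h1 h2 ⊢
    refine mem_residues_of_isRelPrime D hc0 hm hfree hf hfg ?_ ?_
    · rwa [smul_smul, mul_comm]
    · rwa [smul_smul, mul_comm]
  · obtain ⟨g, hg, hpg⟩ := hp p h1 h2
    exact ⟨g, (hJ g).mpr hg, hpg⟩

end Residue

section ProjectiveDimension

theorem projective_Omega_zero (A : Arrangement K ℓ) (m : (Fin ℓ → K) → ℕ) :
    Module.Projective (PS K ℓ) (Omega A m 0) := by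
  let μ : PS K ℓ →ₗ[PS K ℓ] ExtF K ℓ := Qpoly A m • Algebra.linearMap _ _
  have hμ : ∀ s, μ s = Qpoly A m • algebraMap _ _ s := fun s => rfl
  have hinj : Function.Injective μ := fun s t h => by
    rw [hμ, hμ] at h
    exact ExteriorAlgebra.algebraMap_leftInverse _ |>.injective
      (smul_cancel (Qpoly_ne_zero A m) h)
  have heq : LinearMap.range μ = Omega A m 0 := by
    ext ζ
    rw [Omega_eq, Submodule.mem_inf, formsP, pow_zero, Submodule.mem_one]
    constructor
    · rintro ⟨s, rfl⟩
      exact ⟨⟨Qpoly A m * s, by rw [hμ, map_mul, ← Algebra.smul_def]⟩,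
        Qpoly_smul_mem_logForms A m _⟩
    · rintro ⟨⟨f, rfl⟩, hf⟩
      obtain ⟨y, hy⟩ := exists_eq_Qpoly_smul (A := A) (m := m) (x := algebraMap _ (ExtF K ℓ) f)
        fun c hc => by
          obtain ⟨v, hv⟩ := exists_dotLin_eq_one (A.ne_zero c hc)
          obtain ⟨ξ, h⟩ := mem_logForms.mp hf c hc
          have h2 := eq_dP_mul_add hv h
          have h3 : contr v (algebraMap _ _ f) = 0 := CliffordAlgebra.contractLeft_algebraMap _ _ f
          rw [h3, mul_zero, zero_add] at h2
          exact ⟨_, h2⟩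
      refine ⟨ExteriorAlgebra.algebraMapInv y, ?_⟩
      have h4 := congrArg ExteriorAlgebra.algebraMapInv hy
      rw [map_smul, ExteriorAlgebra.algebraMap_leftInverse _ f] at h4
      rw [hμ, h4, smul_eq_mul, map_mul, ← Algebra.smul_def]
  rw [← heq]
  exact Module.Projective.of_equiv (LinearEquiv.ofInjective μ hinj)

variable {c0 : Fin ℓ → K} {e : (Fin (ℓ - 1) → K) →ₗ[K] (Fin ℓ → K)} {A : Arrangement K ℓ}
  {m : (Fin ℓ → K) → ℕ}

theorem isRes_linearCombination {J : Type} {n : ℕ} {ζ : J → ExtF K ℓ} {z : J → ExtF K (ℓ - 1)}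
    (h : ∀ j, IsRes c0 e n (ζ j) (z j)) (a : J →₀ PS K ℓ) :
    IsRes c0 e n (Finsupp.linearCombination _ ζ a)
      (Finsupp.linearCombination _ z (a.mapRange (resP e) (map_zero _))) := by
  induction a using Finsupp.induction_linear with
  | zero => simpa using IsRes.zero
  | add a b ha hb =>
    rw [Finsupp.mapRange_add (map_add _), map_add, map_add]
    exact ha.add hb
  | single j s =>
    rw [Finsupp.mapRange_single, Finsupp.linearCombination_single,
      Finsupp.linearCombination_single]
    exact (h j).smul s

theorem projective_ker_coprod {R M J : Type} [CommRing R] [IsDomain R] [AddCommGroup M] [Module R M]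
    {Z Z' : Submodule R M} (hle : Z ≤ Z') {α : R} (hα : α ≠ 0) (f : (J →₀ R) →ₗ[R] Z')
    (h1 : ∀ a, α • (f a : M) ∈ Z) (h2 : ∀ a, (f a : M) ∈ Z → ∃ b, a = α • b) :
    Module.Projective R (LinearMap.ker ((Submodule.inclusion hle).coprod f)) := by
  let k₁ : (J →₀ R) →ₗ[R] Z :=
    LinearMap.codRestrict _ (-(α • Z'.subtype.comp f)) fun a => neg_mem (h1 a)
  have hk₁ : ∀ a, (k₁ a : M) = -(α • (f a : M)) := fun a => rfl
  let k : (J →₀ R) →ₗ[R] LinearMap.ker ((Submodule.inclusion hle).coprod f) :=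
    LinearMap.codRestrict _ (k₁.prod (α • LinearMap.id)) fun a => by
      rw [LinearMap.mem_ker]
      apply Subtype.ext
      simp [hk₁]
  have hk : ∀ a, (k a : Z × (J →₀ R)) = (k₁ a, α • a) := fun a => rfl
  refine Module.Projective.of_equiv (LinearEquiv.ofBijective k ⟨fun a a' h => ?_, ?_⟩)
  · have h3 := congrArg (fun x => (Subtype.val x).2) h
    simp only [hk] at h3
    exact smul_cancel hα h3
  · rintro ⟨⟨z, a⟩, hza⟩
    have h3 := congrArg Subtype.val (LinearMap.mem_ker.mp hza)
    have h4 : (z : M) + f a = 0 := by simpa using h3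
    obtain ⟨a', rfl⟩ := h2 a (by
      rw [eq_neg_of_add_eq_zero_right h4]
      exact neg_mem z.2)
    refine ⟨a', Subtype.ext (Prod.ext (Subtype.ext ?_) rfl)⟩
    rw [hk]
    simp only [hk₁]
    rw [map_smul, Submodule.coe_smul] at h4
    exact (eq_neg_of_add_eq_zero_left h4).symm

theorem pdLE_one_Omega (D : HypSplitting c0 e) (hc0 : c0 ∈ A.hyps) (hm : 0 < m c0)
    (hfree : Module.Free (PS K ℓ) (logForms A m))
    (hres : Module.Free (PS K (ℓ - 1)) (residues D A m)) (p : ℕ) :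
    pdLE (PS K ℓ) 1 (Omega A (mdel m c0) p) := by
  let i : Omega A (mdel m c0) p →ₗ[PS K ℓ] logForms A (mdel m c0) :=
    Submodule.inclusion (by rw [Omega_eq]; exact inf_le_right)
  let s : logForms A (mdel m c0) →ₗ[PS K ℓ] Omega A (mdel m c0) p :=
    LinearMap.codRestrict _ ((extProj _ _ p).comp (Submodule.subtype _)) fun ζ => by
      rw [Omega_eq]
      exact ⟨extProj_mem p _, extProj_mem_logForms ζ.2 p⟩
  have hsi : ∀ x, s (i x) = x := fun x => Subtype.ext (extProj_of_mem x.2.1)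
  let b := Module.Free.chooseBasis (PS K (ℓ - 1)) (residues D A m)
  choose ζ hζ hζr using fun j => mem_residues.mp (b j).2
  have hb : ∀ t, ((Finsupp.linearCombination (PS K (ℓ - 1)) b t : residues D A m) :
      ExtF K (ℓ - 1)) = Finsupp.linearCombination (PS K (ℓ - 1))
        (fun j => (b j : ExtF K (ℓ - 1))) t := fun t => by
    simp only [Finsupp.linearCombination_apply, Finsupp.sum, Submodule.coe_sum,
      Submodule.coe_smul]
  have hr : ∀ a, IsRes c0 e (m c0 - 1) (Finsupp.linearCombination _ ζ a)
      ((Finsupp.linearCombination (PS K (ℓ - 1)) b (a.mapRange (resP e) (map_zero _)) :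
        residues D A m) : ExtF K (ℓ - 1)) := fun a => by
    rw [hb]
    exact isRes_linearCombination hζr a
  have hmem : ∀ a, Finsupp.linearCombination _ ζ a ∈ logForms A (mdel m c0) := fun a =>
    Submodule.sum_mem _ fun j _ => Submodule.smul_mem _ _ (hζ j)
  have := hfree
  have := projective_ker_coprod (logForms_le_mdel A m c0) (linP_ne_zero D.ne_zero)
    (LinearMap.codRestrict _ (Finsupp.linearCombination (PS K ℓ) ζ) hmem)
    (fun a => (linP_smul_mem_iff hc0 hm).mpr (hmem a)) fun a ha => by
      have h4 := (hr a).unique D ((isRes_zero_iff D hc0 hm (hmem a)).mpr ha)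
      have h5 : a.mapRange (resP e) (map_zero _) = 0 :=
        linearIndependent_iff.mp b.linearIndependent _ (Subtype.ext h4)
      refine exists_eq_smul_of_forall_repr Finsupp.basisSingleOne _ _ fun j => ?_
      simpa using D.dvd_of_resP_eq_zero (by simpa using DFunLike.congr_fun h5 j)
  refine pdLE_one_of_retract i s hsi _ (fun x => ?_) this
  obtain ⟨τ, hτ⟩ := exists_isRes (e := e) hc0 x.2
  let t := b.repr ⟨τ, mem_residues.mpr ⟨x, x.2, hτ⟩⟩
  let a := t.mapRange D.liftP (map_zero _)
  have ha : a.mapRange (resP e) (map_zero _) = t := by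
    ext1 j
    simp [a, D.resP_liftP]
  have h1 := hτ.sub (hr a)
  rw [ha, b.linearCombination_repr, sub_self,
    isRes_zero_iff D hc0 hm (sub_mem x.2 (hmem a))] at h1
  refine ⟨(⟨_, h1⟩, a), Subtype.ext ?_⟩
  rw [LinearMap.coprod_apply, Submodule.coe_add, LinearMap.codRestrict_apply,
    Submodule.coe_inclusion, sub_add_cancel]

theorem tameM_mdel_of_free_residues (D : HypSplitting c0 e) (hc0 : c0 ∈ A.hyps) (hm : 0 < m c0)
    (hfree : Module.Free (PS K ℓ) (logForms A m))
    (hres : Module.Free (PS K (ℓ - 1)) (residues D A m)) : TameM A (mdel m c0) := by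
  intro p _
  rcases Nat.eq_zero_or_pos p with rfl | hp
  · exact projective_Omega_zero A _
  · exact pdLE_mono hp (pdLE_one_Omega D hc0 hm hfree hres p)

end ProjectiveDimension

section OneForms

/-- Evaluation of a one-form on the constant vector field `v`. -/
def evalForm (v : Fin ℓ → K) : (Fin ℓ → PS K ℓ) →ₗ[PS K ℓ] PS K ℓ :=
  ∑ i, (C (v i) : PS K ℓ) • LinearMap.proj i

theorem evalForm_apply (v : Fin ℓ → K) (f : Fin ℓ → PS K ℓ) :
    evalForm v f = ∑ i, C (v i) * f i := by
  simp [evalForm]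

theorem evalForm_single (i : Fin ℓ) (f : Fin ℓ → PS K ℓ) :
    evalForm (Pi.single i (1 : K)) f = f i := by
  rw [evalForm_apply, Finset.sum_eq_single i (fun j _ hj => by simp [hj]) (by simp)]
  simp

theorem evalForm_add_left (u v : Fin ℓ → K) (f : Fin ℓ → PS K ℓ) :
    evalForm (u + v) f = evalForm u f + evalForm v f := by
  simp only [evalForm_apply, Pi.add_apply, C_add, add_mul, Finset.sum_add_distrib]

theorem evalForm_smul_left (t : K) (v : Fin ℓ → K) (f : Fin ℓ → PS K ℓ) :
    evalForm (t • v) f = C t * evalForm v f := by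
  simp only [evalForm_apply, Pi.smul_apply, smul_eq_mul, C_mul, mul_assoc, Finset.mul_sum]

theorem evalForm_isHomogeneous (v : Fin ℓ → K) {f : Fin ℓ → PS K ℓ} {d : ℕ}
    (hf : ∀ i, (f i).IsHomogeneous d) : (evalForm v f).IsHomogeneous d := by
  rw [evalForm_apply]
  exact IsHomogeneous.sum _ _ _ fun i _ => by simpa using (isHomogeneous_C _ (v i)).mul (hf i)

theorem contr_ι (v : Fin ℓ → K) (f : Fin ℓ → PS K ℓ) :
    contr v (ExteriorAlgebra.ι _ f) = algebraMap _ _ (evalForm v f) := by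
  have := contr_ι_mul v f 1
  have h1 : contr v (1 : ExtF K ℓ) = 0 :=
    CliffordAlgebra.contractLeft_one (Q := (0 : QuadraticForm (PS K ℓ) (Fin ℓ → PS K ℓ))) _
  rwa [mul_one, h1, mul_zero, sub_zero, ← evalForm_apply, ← Algebra.algebraMap_eq_smul_one] at this

theorem contr_algebraMap (v : Fin ℓ → K) (s : PS K ℓ) :
    contr v (algebraMap _ (ExtF K ℓ) s) = 0 :=
  CliffordAlgebra.contractLeft_algebraMap (Q := (0 : QuadraticForm (PS K ℓ) (Fin ℓ → PS K ℓ))) _ _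

theorem dvd_of_algebraMap_eq_smul {a s : PS K ℓ} {x : ExtF K ℓ}
    (h : algebraMap _ (ExtF K ℓ) s = a • x) : a ∣ s := by
  have := congrArg (ExteriorAlgebra.algebraMapInv) h
  rw [ExteriorAlgebra.algebraMap_leftInverse, map_smul, smul_eq_mul] at this
  exact ⟨_, this⟩

theorem ι_mem_logForms_dvd {A : Arrangement K ℓ} {m : (Fin ℓ → K) → ℕ} {f : Fin ℓ → PS K ℓ}
    (hf : ExteriorAlgebra.ι _ f ∈ logForms A m) {c u : Fin ℓ → K} (hc : c ∈ A.hyps)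
    (hu : dotLin c u = 0) : linP c ^ m c ∣ evalForm u f := by
  obtain ⟨ξ, h⟩ := mem_logForms.mp hf c hc
  obtain ⟨v, hv⟩ := exists_dotLin_eq_one (A.ne_zero c hc)
  have h1 := congrArg (contr u) h
  rw [contr_dP_mul, hu, C_0, zero_smul, zero_sub, contr_ι, map_smul] at h1
  have h2 := congrArg (contr v) h1
  rw [map_neg, contr_dP_mul, hv, C_1, one_smul, contr_algebraMap, mul_zero, sub_zero,
    map_smul] at h2
  exact dvd_of_algebraMap_eq_smul (x := - contr v (contr u ξ)) (by rw [smul_neg, ← h2, neg_neg])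

theorem IsHomogForm.exists_ι {d : ℕ} {η : ExtF K ℓ} (h : IsHomogForm 1 d η) :
    ∃ f : Fin ℓ → PS K ℓ, (∀ i, (f i).IsHomogeneous d) ∧ η = ExteriorAlgebra.ι _ f := by
  induction h using AddSubgroup.closure_induction with
  | mem x hx =>
    obtain ⟨f, l, hf, hl, rfl⟩ := hx
    obtain ⟨i, rfl⟩ := List.length_eq_one_iff.mp hl
    refine ⟨f • Pi.single i 1, fun j => ?_, by simp [wedgeList]⟩
    rw [Pi.smul_apply, Pi.single_apply]
    split_ifs
    · simpa using hf
    · simpa using isHomogeneous_zero _ _ d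
  | zero => exact ⟨0, fun i => isHomogeneous_zero _ _ d, by simp⟩
  | add x y _ _ hx hy =>
    obtain ⟨f, hf, rfl⟩ := hx
    obtain ⟨g, hg, rfl⟩ := hy
    exact ⟨f + g, fun i => (hf i).add (hg i), by simp⟩
  | neg x _ hx =>
    obtain ⟨f, hf, rfl⟩ := hx
    exact ⟨-f, fun i => (hf i).neg, by simp⟩

theorem FreeWithExp.exists_basis {A : Arrangement K ℓ} {m : (Fin ℓ → K) → ℕ} {d : Fin ℓ → ℕ}
    (h : FreeWithExp A m d) : ∃ β : Fin ℓ → Fin ℓ → PS K ℓ,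
      (∀ i, ExteriorAlgebra.ι _ (β i) ∈ logForms A m) ∧
      (∀ i j, (β i j).IsHomogeneous (msum A m - d i)) ∧ LinearIndependent (PS K ℓ) β ∧
      ∀ f, ExteriorAlgebra.ι _ f ∈ logForms A m → ∃ q : Fin ℓ → PS K ℓ, f = ∑ i, q i • β i := by
  obtain ⟨b, hb, hd, hli, hsp⟩ := h
  choose β hβ hbβ using fun i => (hd i).exists_ι
  obtain rfl : b = fun i => ExteriorAlgebra.ι _ (β i) := funext hbβ
  refine ⟨β, fun i => mem_Omega_one.mp (hb i), hβ, hli.of_comp (ExteriorAlgebra.ι _),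
    fun f hf => ?_⟩
  obtain ⟨q, hq⟩ := (Submodule.mem_span_range_iff_exists_fun _).mp (hsp (mem_Omega_one.mpr hf))
  refine ⟨q, (ExteriorAlgebra.ι_leftInverse (R := PS K ℓ)).injective ?_⟩
  rw [← hq, map_sum]
  simp

theorem homogeneousComponent_mul_of_isHomogeneous {f g : PS K ℓ} {e : ℕ} (hg : g.IsHomogeneous e)
    (d : ℕ) : homogeneousComponent d (f * g) =
      if e ≤ d then homogeneousComponent (d - e) f * g else 0 := by
  have key : ∀ i, homogeneousComponent d (homogeneousComponent i f * g) =
      if d = i + e then homogeneousComponent i f * g else 0 := fun i =>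
    homogeneousComponent_of_mem ((homogeneousComponent_isHomogeneous i f).mul hg)
  conv_lhs => rw [← sum_homogeneousComponent f, Finset.sum_mul, map_sum]
  simp only [key]
  split_ifs with h
  · rw [Finset.sum_eq_single (d - e), if_pos (by omega)]
    · intro i _ hi
      exact if_neg (by omega)
    · intro hi
      rw [homogeneousComponent_eq_zero _ _ (by simp only [Finset.mem_range, not_lt] at hi; omega)]
      simp
  · exact Finset.sum_eq_zero fun i _ => if_neg (by omega)

theorem exists_homogeneous_repr {β : Fin ℓ → Fin ℓ → PS K ℓ} {e : Fin ℓ → ℕ}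
    (hβ : ∀ i j, (β i j).IsHomogeneous (e i)) {f : Fin ℓ → PS K ℓ} {d : ℕ}
    (hf : ∀ j, (f j).IsHomogeneous d) {q : Fin ℓ → PS K ℓ} (hq : f = ∑ i, q i • β i) :
    ∃ q' : Fin ℓ → PS K ℓ, f = ∑ i, q' i • β i ∧ ∀ i, d < e i → q' i = 0 := by
  refine ⟨fun i => if e i ≤ d then homogeneousComponent (d - e i) (q i) else 0, ?_,
    fun i hi => if_neg (by omega)⟩
  ext1 j
  rw [← homogeneousComponent_eq_self (hf j)]
  conv_lhs => rw [hq]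
  simp only [Finset.sum_apply, Pi.smul_apply, smul_eq_mul, map_sum,
    homogeneousComponent_mul_of_isHomogeneous (hβ _ j), ite_mul, zero_mul]

end OneForms

section Determinant

variable {A : Arrangement K ℓ} {m : (Fin ℓ → K) → ℕ}

theorem Qpoly_dvd_of_forall {s : PS K ℓ} (h : ∀ c ∈ A.hyps, linP c ^ m c ∣ s) :
    Qpoly A m ∣ s := Finset.prod_dvd_of_isRelPrime (A.pairwise_isRelPrime m) h

theorem sum_degree_le_of_basis {β : Fin ℓ → Fin ℓ → PS K ℓ} {e : Fin ℓ → ℕ}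
    (hβ : ∀ i j, (β i j).IsHomogeneous (e i))
    (hsp : ∀ f, ExteriorAlgebra.ι _ f ∈ logForms A m → ∃ q : Fin ℓ → PS K ℓ, f = ∑ i, q i • β i) :
    ∑ i, e i + msum A m ≤ ℓ * msum A m := by
  have hQ := Qpoly_ne_zero A m
  have hι : ∀ j : Fin ℓ, ∃ q : Fin ℓ → PS K ℓ, Qpoly A m • Pi.single j 1 = ∑ i, q i • β i :=
    fun j => hsp _ (by rw [map_smul]; exact Qpoly_smul_mem_logForms A m _)
  choose N hN using hι
  have hmul : Matrix.of N * Matrix.of β = Qpoly A m • (1 : Matrix (Fin ℓ) (Fin ℓ) (PS K ℓ)) := by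
    ext j k : 2
    have := congrFun (hN j) k
    simp only [Finset.sum_apply, Pi.smul_apply, smul_eq_mul] at this
    rw [Matrix.mul_apply, Matrix.smul_apply, Matrix.one_apply, smul_eq_mul]
    simp only [Matrix.of_apply]
    rw [← this, Pi.single_apply]
    simp [eq_comm]
  have hdet := congrArg Matrix.det hmul
  rw [Matrix.det_mul, Matrix.det_smul, Matrix.det_one, mul_one, Fintype.card_fin] at hdet
  have h0 : (Matrix.of N).det * (Matrix.of β).det ≠ 0 := hdet ▸ pow_ne_zero _ hQ
  have hN0 := left_ne_zero_of_mul h0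
  have hβ0 := right_ne_zero_of_mul h0
  have hβdeg : (Matrix.of β).det.IsHomogeneous (∑ i, e i) := by
    rw [Matrix.det_apply]
    refine IsHomogeneous.sum _ _ _ fun σ _ => ?_
    rw [Units.smul_def, zsmul_eq_mul, ← Equiv.sum_comp σ e]
    have h1 : ((((Equiv.Perm.sign σ : ℤˣ) : ℤ) : PS K ℓ)).IsHomogeneous 0 := by
      rw [← map_intCast (C : K →+* PS K ℓ)]
      exact isHomogeneous_C _ _
    simpa using h1.mul (IsHomogeneous.prod Finset.univ _ _ fun i _ => hβ (σ i) i)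
  have hdvd : Qpoly A m ∣ (Matrix.of N).det := by
    refine Qpoly_dvd_of_forall fun c hc => ?_
    obtain ⟨q, hq⟩ := hsp (fun i => (∏ d ∈ A.hyps.erase c, linP d ^ m d) * C (c i)) (by
      rw [show (fun i => (∏ d ∈ A.hyps.erase c, linP d ^ m d) * C (c i)) =
        (∏ d ∈ A.hyps.erase c, linP d ^ m d) • fun i => (C (c i) : PS K ℓ) from rfl, map_smul]
      exact prod_erase_smul_dP_mem_logForms m hc)
    have hcN : Matrix.vecMul (fun i => C (c i)) (Matrix.of N) = linP c ^ m c • q := by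
      rw [← sub_eq_zero]
      refine Matrix.eq_zero_of_vecMul_eq_zero hβ0 ?_
      rw [Matrix.sub_vecMul, sub_eq_zero, Matrix.vecMul_vecMul, hmul, Matrix.vecMul_smul,
        Matrix.vecMul_one, Matrix.smul_vecMul,
        show Matrix.vecMul q (Matrix.of β) = ∑ i, q i • β i from Matrix.vecMul_eq_sum _ _, ← hq]
      ext1 i
      simp only [Pi.smul_apply, smul_eq_mul]
      rw [← mul_assoc, Finset.mul_prod_erase _ (fun d => linP d ^ m d) hc, Qpoly]
    obtain ⟨i, hi⟩ := Function.ne_iff.mp (A.ne_zero c hc)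
    have h2 := congrArg (fun x => Matrix.vecMul x (Matrix.of N).adjugate) hcN
    simp only [Matrix.vecMul_vecMul, Matrix.mul_adjugate, Matrix.vecMul_smul, Matrix.vecMul_one,
      Matrix.smul_vecMul] at h2
    have h3 := congrFun h2 i
    simp only [Pi.smul_apply, smul_eq_mul] at h3
    have hu : IsUnit (C (c i) : PS K ℓ) := (isUnit_iff_ne_zero.mpr hi).map C
    exact hu.dvd_mul_right.mp ⟨_, h3⟩
  obtain ⟨g, hg⟩ := hdvd
  have hg0 : g ≠ 0 := right_ne_zero_of_mul (hg ▸ hN0)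
  have hdeg := congrArg totalDegree hdet
  rw [hg, totalDegree_mul_of_isDomain (mul_ne_zero hQ hg0) hβ0, totalDegree_mul_of_isDomain hQ hg0,
    (Qpoly_isHomogeneous A m).totalDegree hQ, hβdeg.totalDegree hβ0,
    ((Qpoly_isHomogeneous A m).pow ℓ).totalDegree (pow_ne_zero _ hQ), mul_comm (msum A m)] at hdeg
  omega

end Determinant

section RankTwo

variable {A : Arrangement K ℓ} {m : (Fin ℓ → K) → ℕ} {c0 c1 : Fin ℓ → K}

/-- Vectors dual to two forms `c0`, `c1` of `A` which span all the forms of `A`. -/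
structure RankTwoFrame (A : Arrangement K ℓ) (c0 c1 : Fin ℓ → K) : Type where
  v : Fin ℓ → K
  w : Fin ℓ → K
  mem0 : c0 ∈ A.hyps
  mem1 : c1 ∈ A.hyps
  dot0v : dotLin c0 v = 1
  dot0w : dotLin c0 w = 0
  dot1v : dotLin c1 v = 0
  dot1w : dotLin c1 w = 1
  span : ∀ c ∈ A.hyps, ∃ s t : K, c = s • c0 + t • c1

/-- The one-forms in the span of `dα_{c0}` and `dα_{c1}`. -/
def IsTransversal (c0 c1 : Fin ℓ → K) (f : Fin ℓ → PS K ℓ) : Prop :=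
  ∀ u, dotLin c0 u = 0 → dotLin c1 u = 0 → evalForm u f = 0

theorem evalForm_eq_zero_of_dvd {u : Fin ℓ → K} {f : Fin ℓ → PS K ℓ} {d n : ℕ} {a : PS K ℓ}
    (ha : a.IsHomogeneous n) (hf : ∀ i, (f i).IsHomogeneous d) (hd : d < n)
    (h : a ∣ evalForm u f) : evalForm u f = 0 := by
  by_contra h0
  obtain ⟨q, hq⟩ := h
  have ha0 : a ≠ 0 := fun h1 => h0 (by rw [hq, h1, zero_mul])
  have hq0 : q ≠ 0 := fun h1 => h0 (by rw [hq, h1, mul_zero])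
  have h1 := (evalForm_isHomogeneous u hf).totalDegree h0
  rw [hq, totalDegree_mul_of_isDomain ha0 hq0, ha.totalDegree ha0] at h1
  omega

namespace RankTwoFrame

theorem two_le (F : RankTwoFrame A c0 c1) : 2 ≤ ℓ := by
  have h1 := F.dot0v
  have h2 := F.dot0w
  have h3 := F.dot1w
  rw [dotLin_apply] at h1 h2 h3
  match ℓ with
  | 0 => simp at h1
  | 1 =>
    simp only [Fin.sum_univ_one] at h1 h2 h3
    rw [(mul_eq_zero.mp h2).resolve_left (left_ne_zero_of_mul (h1 ▸ one_ne_zero))] at h3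
    simp at h3
  | n + 2 => omega

theorem exists_decomp (F : RankTwoFrame A c0 c1) (x : Fin ℓ → K) :
    ∃ u, dotLin c0 u = 0 ∧ dotLin c1 u = 0 ∧ x = dotLin c0 x • F.v + dotLin c1 x • F.w + u :=
  ⟨x - (dotLin c0 x • F.v + dotLin c1 x • F.w), by simp [F.dot0v, F.dot0w],
    by simp [F.dot1v, F.dot1w], by abel⟩

theorem evalForm_eq (F : RankTwoFrame A c0 c1) {f : Fin ℓ → PS K ℓ} (hf : IsTransversal c0 c1 f)
    (x : Fin ℓ → K) : evalForm x f =
      C (dotLin c0 x) * evalForm F.v f + C (dotLin c1 x) * evalForm F.w f := by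
  obtain ⟨u, h0, h1, hx⟩ := F.exists_decomp x
  conv_lhs => rw [hx]
  rw [evalForm_add_left, evalForm_add_left, evalForm_smul_left, evalForm_smul_left, hf u h0 h1,
    add_zero]

theorem eq_zero_of_evalForm (F : RankTwoFrame A c0 c1) {f : Fin ℓ → PS K ℓ}
    (hf : IsTransversal c0 c1 f) (hv : evalForm F.v f = 0) (hw : evalForm F.w f = 0) : f = 0 := by
  ext1 i
  rw [← evalForm_single i f, F.evalForm_eq hf, hv, hw]
  simp

theorem ι_eq (F : RankTwoFrame A c0 c1) {f : Fin ℓ → PS K ℓ} (hf : IsTransversal c0 c1 f) :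
    ExteriorAlgebra.ι (PS K ℓ) f = evalForm F.v f • dP c0 + evalForm F.w f • dP c1 := by
  rw [dP, dP, ← map_smul, ← map_smul, ← map_add]
  congr 1
  ext1 i
  rw [← evalForm_single i f, F.evalForm_eq hf, dotLin_apply, dotLin_apply,
    Finset.sum_eq_single i (by simp +contextual) (by simp),
    Finset.sum_eq_single i (by simp +contextual) (by simp)]
  simp [mul_comm]

/-- The coefficient of `dα_{c0} ∧ dα_{c1}` in `f ∧ g`. -/
def wedge (F : RankTwoFrame A c0 c1) (f g : Fin ℓ → PS K ℓ) : PS K ℓ :=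
  evalForm F.v f * evalForm F.w g - evalForm F.w f * evalForm F.v g

theorem Qpoly_dvd_wedge (F : RankTwoFrame A c0 c1) {f g : Fin ℓ → PS K ℓ}
    (hf : ExteriorAlgebra.ι _ f ∈ logForms A m) (hg : ExteriorAlgebra.ι _ g ∈ logForms A m) :
    Qpoly A m ∣ F.wedge f g := by
  obtain ⟨ξ, _, h⟩ := exists_mul_eq_Qpoly_smul hf hg
  have h1 := congrArg (fun x => contr F.w (contr F.v x)) h
  simp only [contr_ι_mul, ← evalForm_apply, contr_ι, map_sub, map_smul, contr_algebraMap, mul_zero,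
    sub_zero] at h1
  refine dvd_of_algebraMap_eq_smul (x := contr F.w (contr F.v ξ)) ?_
  rw [← h1, wedge, map_sub, Algebra.smul_def, ← map_mul, Algebra.smul_def, ← map_mul]

theorem wedge_isHomogeneous (F : RankTwoFrame A c0 c1) {f g : Fin ℓ → PS K ℓ} {a b : ℕ}
    (hf : ∀ i, (f i).IsHomogeneous a) (hg : ∀ i, (g i).IsHomogeneous b) :
    (F.wedge f g).IsHomogeneous (a + b) :=
  ((evalForm_isHomogeneous _ hf).mul (evalForm_isHomogeneous _ hg)).sub
    ((evalForm_isHomogeneous _ hf).mul (evalForm_isHomogeneous _ hg))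

theorem wedge_ne_zero (F : RankTwoFrame A c0 c1) {f g : Fin ℓ → PS K ℓ}
    (hf : IsTransversal c0 c1 f) (hg : IsTransversal c0 c1 g)
    (hfg : LinearIndependent (PS K ℓ) ![f, g]) : F.wedge f g ≠ 0 := by
  intro h
  rw [wedge] at h
  rw [LinearIndependent.pair_iff] at hfg
  have key : ∀ s t : PS K ℓ, s * evalForm F.v f + t * evalForm F.v g = 0 →
      s * evalForm F.w f + t * evalForm F.w g = 0 → s = 0 ∧ t = 0 := fun s t h1 h2 => by
    refine hfg s t (F.eq_zero_of_evalForm (fun u h0 h1 => ?_) ?_ ?_)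
    · rw [map_add, map_smul, map_smul, hf u h0 h1, hg u h0 h1, smul_zero, smul_zero, add_zero]
    · rw [map_add, map_smul, map_smul, smul_eq_mul, smul_eq_mul, h1]
    · rw [map_add, map_smul, map_smul, smul_eq_mul, smul_eq_mul, h2]
  have h1 := key (evalForm F.w g) (-evalForm F.w f) (by linear_combination h) (by ring)
  have h2 := key (-evalForm F.v g) (evalForm F.v f) (by ring) (by linear_combination h)
  have h3 := key 1 0 (by rw [h2.2]; ring) (by rw [neg_eq_zero.mp h1.2]; ring)
  exact one_ne_zero h3.1

theorem wedge_smul_left (F : RankTwoFrame A c0 c1) (f g : Fin ℓ → PS K ℓ) (p : PS K ℓ) :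
    F.wedge (p • f) g = p * F.wedge f g := by
  simp only [wedge, map_smul, smul_eq_mul]
  ring

theorem wedge_smul_right (F : RankTwoFrame A c0 c1) (f g : Fin ℓ → PS K ℓ) (p : PS K ℓ) :
    F.wedge f (p • g) = p * F.wedge f g := by
  simp only [wedge, map_smul, smul_eq_mul]
  ring

theorem wedge_swap (F : RankTwoFrame A c0 c1) (f g : Fin ℓ → PS K ℓ) :
    F.wedge f g = -F.wedge g f := by
  simp only [wedge]
  ring

theorem eq_zero_of_wedge (F : RankTwoFrame A c0 c1) {f g h : Fin ℓ → PS K ℓ}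
    (hh : IsTransversal c0 c1 h) (hfg : F.wedge f g ≠ 0) (hf : F.wedge f h = 0)
    (hg : F.wedge g h = 0) : h = 0 := by
  rw [wedge] at hfg hf hg
  refine F.eq_zero_of_evalForm hh ?_ ?_
  · refine (mul_eq_zero.mp ?_).resolve_left hfg
    linear_combination evalForm F.v g * hf - evalForm F.v f * hg
  · refine (mul_eq_zero.mp ?_).resolve_left hfg
    linear_combination evalForm F.w g * hf - evalForm F.w f * hg

theorem isTransversal_of_degree_lt (F : RankTwoFrame A c0 c1) {f : Fin ℓ → PS K ℓ}
    (hf : ExteriorAlgebra.ι _ f ∈ logForms A m) {d : ℕ} (hd : ∀ i, (f i).IsHomogeneous d)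
    (hlt : d < msum A m) : IsTransversal c0 c1 f := by
  intro u h0 h1
  refine evalForm_eq_zero_of_dvd (Qpoly_isHomogeneous A m) hd hlt
    (Qpoly_dvd_of_forall fun c hc => ι_mem_logForms_dvd hf hc ?_)
  obtain ⟨s, t, rfl⟩ := F.span c hc
  rw [dotLin_apply] at h0 h1 ⊢
  simp only [Pi.add_apply, Pi.smul_apply, smul_eq_mul, add_mul, Finset.sum_add_distrib, mul_assoc,
    ← Finset.mul_sum, h0, h1, mul_zero, add_zero]

theorem degree_ne_zero (F : RankTwoFrame A c0 c1) (h0 : 0 < m c0) (h1 : 0 < m c1)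
    {f : Fin ℓ → PS K ℓ} (hf : ExteriorAlgebra.ι _ f ∈ logForms A m) {d : ℕ}
    (hd : ∀ i, (f i).IsHomogeneous d) (hne : f ≠ 0) : d ≠ 0 := by
  rintro rfl
  have key : ∀ c ∈ A.hyps, 0 < m c → ∀ u, dotLin c u = 0 → evalForm u f = 0 := fun c hc hm u hu =>
    evalForm_eq_zero_of_dvd ((linP_isHomogeneous c).pow (m c)) hd (by simpa using hm)
      (ι_mem_logForms_dvd hf hc hu)
  exact hne (F.eq_zero_of_evalForm (fun u hu _ => key c0 F.mem0 h0 u hu)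
    (key c1 F.mem1 h1 _ F.dot1v) (key c0 F.mem0 h0 _ F.dot0w))

theorem exists_pair (F : RankTwoFrame A c0 c1) {d1 d2 : ℕ}
    (h : FreeWithExp A m (expVec d1 d2)) : ∃ f g : Fin ℓ → PS K ℓ,
      ExteriorAlgebra.ι _ f ∈ logForms A m ∧ ExteriorAlgebra.ι _ g ∈ logForms A m ∧
      (∀ i, (f i).IsHomogeneous (msum A m - d1)) ∧ (∀ i, (g i).IsHomogeneous (msum A m - d2)) ∧
      LinearIndependent (PS K ℓ) ![f, g] ∧
      (msum A m - d1) + (msum A m - d2) ≤ msum A m ∧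
      ∀ x, ExteriorAlgebra.ι _ x ∈ logForms A m → ∀ d < msum A m, (∀ i, (x i).IsHomogeneous d) →
        ∃ p q : PS K ℓ, x = p • f + q • g ∧ (d < msum A m - d1 → p = 0) ∧
          (d < msum A m - d2 → q = 0) := by
  obtain ⟨k, rfl⟩ := Nat.exists_eq_add_of_le' F.two_le
  obtain ⟨β, hβ, hdeg, hli, hsp⟩ := h.exists_basis
  have e0 : expVec d1 d2 (0 : Fin (k + 2)) = d1 := rfl
  have e1 : expVec d1 d2 (1 : Fin (k + 2)) = d2 := by simp [expVec]
  have e2 : ∀ i : Fin k, expVec d1 d2 i.succ.succ = 0 := fun i => by simp [expVec]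
  refine ⟨β 0, β 1, hβ 0, hβ 1, by simpa [e0] using hdeg 0, by simpa [e1] using hdeg 1, ?_, ?_, ?_⟩
  · have := hli.comp ![0, 1] (by
      intro i j
      fin_cases i <;> fin_cases j <;> simp)
    convert this using 1
    ext1 i
    fin_cases i <;> rfl
  · have := sum_degree_le_of_basis hdeg hsp
    rw [Fin.sum_univ_succ, Fin.sum_univ_succ, e0, Fin.succ_zero_eq_one, e1] at this
    simp only [e2, Nat.sub_zero, Finset.sum_const, Finset.card_univ, Fintype.card_fin, smul_eq_mul,
      add_mul] at this
    omega
  · intro x hx d hd hxd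
    obtain ⟨q, hq⟩ := hsp x hx
    obtain ⟨q, rfl, hq0⟩ := exists_homogeneous_repr hdeg hxd hq
    refine ⟨q 0, q 1, ?_, fun h => hq0 0 (by rwa [e0]), fun h => hq0 1 (by rwa [e1])⟩
    rw [Fin.sum_univ_succ, Fin.sum_univ_succ, Finset.sum_eq_zero, add_zero, Fin.succ_zero_eq_one]
    intro i _
    rw [hq0 _ (by rwa [e2, Nat.sub_zero]), zero_smul]

end RankTwoFrame

theorem msum_mdel {A : Arrangement K ℓ} {m : (Fin ℓ → K) → ℕ} {c0 : Fin ℓ → K} (hc0 : c0 ∈ A.hyps)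
    (hm : 0 < m c0) :
    msum A (mdel m c0) + 1 = msum A m := by
  rw [msum, msum, ← Finset.add_sum_erase _ _ hc0, ← Finset.add_sum_erase _ m hc0, mdel_self,
    Finset.sum_congr rfl fun c hc => mdel_of_ne m (Finset.ne_of_mem_erase hc)]
  omega

namespace RankTwoFrame

/-- The Euler restriction exponents are realized by transversal one-forms. -/
theorem exists_euler_pair (F : RankTwoFrame A c0 c1) (h0 : 0 < m c0) (h1 : 0 < m c1) {d1 d2 : ℕ}
    (h : FreeWithExp A m (expVec d1 d2)) (h' : FreeWithExp A (mdel m c0) (expVec (d1 - 1) d2)) :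
    ∃ ψ θ : Fin ℓ → PS K ℓ, ExteriorAlgebra.ι _ ψ ∈ logForms A m ∧
      ExteriorAlgebra.ι _ θ ∈ logForms A (mdel m c0) ∧ IsTransversal c0 c1 ψ ∧
      IsTransversal c0 c1 θ ∧ (∀ i, (ψ i).IsHomogeneous d2) ∧ F.wedge ψ θ ≠ 0 ∧
      (F.wedge ψ θ).IsHomogeneous (msum A (mdel m c0)) := by
  obtain ⟨f0, f1, hf0, hf1, df0, df1, hf, hle, hfsp⟩ := F.exists_pair h
  obtain ⟨g0, g1, hg0, hg1, dg0, dg1, hg, -, hgsp⟩ := F.exists_pair h'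
  have hM := msum_mdel F.mem0 h0
  have e0 := F.degree_ne_zero h0 h1 hf0 df0 (hf.ne_zero 0)
  have e1 := F.degree_ne_zero h0 h1 hf1 df1 (hf.ne_zero 1)
  have tf0 := F.isTransversal_of_degree_lt hf0 df0 (by omega)
  have tf1 := F.isTransversal_of_degree_lt hf1 df1 (by omega)
  have hw := F.wedge_ne_zero tf0 tf1 hf
  obtain ⟨q, hq⟩ := F.Qpoly_dvd_wedge hf0 hf1
  have hQ := Qpoly_ne_zero A m
  have hq0 : q ≠ 0 := fun h1 => hw (by rw [hq, h1, mul_zero])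
  have hdeg := (F.wedge_isHomogeneous df0 df1).totalDegree hw
  rw [hq, totalDegree_mul_of_isDomain hQ hq0, (Qpoly_isHomogeneous A m).totalDegree hQ] at hdeg
  have hd : d1 + d2 = msum A m := by omega
  have hd1 : 0 < d1 := by omega
  have hd2 : 0 < d2 := by omega
  rw [show msum A m - d1 = d2 by omega] at *
  rw [show msum A m - d2 = d1 by omega] at *
  rw [show msum A (mdel m c0) - (d1 - 1) = d2 by omega] at *
  rw [show msum A (mdel m c0) - d2 = d1 - 1 by omega] at *
  have tg1 := F.isTransversal_of_degree_lt hg1 dg1 (by omega)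
  have hsum : d2 + (d1 - 1) = msum A (mdel m c0) := by omega
  by_cases h01 : F.wedge f0 g1 ≠ 0
  · exact ⟨f0, g1, hf0, hg1, tf0, tg1, df0, h01, hsum ▸ F.wedge_isHomogeneous df0 dg1⟩
  rw [not_not] at h01
  rcases lt_trichotomy d1 d2 with hlt | heq | hgt
  · have hx : ExteriorAlgebra.ι _ (linP c0 • g1) ∈ logForms A m := by
      rw [map_smul]
      exact (linP_smul_mem_iff F.mem0 h0).mpr hg1
    obtain ⟨p, q, hpq, hp, -⟩ := hfsp _ hx d1 (by omega) fun i => by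
      simpa [Nat.add_sub_cancel' hd1] using (linP_isHomogeneous c0).mul (dg1 i)
    rw [hp hlt, zero_smul, zero_add] at hpq
    have h2 := F.wedge_smul_right f0 g1 (linP c0)
    rw [hpq, wedge_smul_right, h01, mul_zero] at h2
    rw [(mul_eq_zero.mp h2).resolve_right hw, zero_smul, smul_eq_zero] at hpq
    exact absurd (hpq.resolve_left (linP_ne_zero (A.ne_zero c0 F.mem0))) (hg.ne_zero 1)
  · refine ⟨f1, g1, hf1, hg1, tf1, tg1, heq ▸ df1, fun h2 => ?_,
      (show d1 + (d1 - 1) = msum A (mdel m c0) by omega) ▸ F.wedge_isHomogeneous df1 dg1⟩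
    exact hg.ne_zero 1 (F.eq_zero_of_wedge tg1 hw h01 h2)
  · have tg0 := F.isTransversal_of_degree_lt hg0 dg0 (by omega)
    have hwg := F.wedge_ne_zero tg0 tg1 hg
    rcases eq_or_ne d2 (d1 - 1) with heq | hne
    · refine ⟨f0, g0, hf0, hg0, tf0, tg0, df0, fun h2 => ?_,
        (show d2 + d2 = msum A (mdel m c0) by omega) ▸ F.wedge_isHomogeneous df0 dg0⟩
      rw [wedge_swap, neg_eq_zero] at h01 h2
      exact hf.ne_zero 0 (F.eq_zero_of_wedge tf0 hwg h2 h01)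
    · obtain ⟨p, q, hpq, -, hq⟩ := hgsp f0 (logForms_le_mdel A m c0 hf0) d2 (by omega) df0
      rw [hq (by omega), zero_smul, add_zero] at hpq
      rw [hpq, wedge_smul_left] at h01
      rw [(mul_eq_zero.mp h01).resolve_right hwg, zero_smul] at hpq
      exact absurd hpq (hf.ne_zero 0)

end RankTwoFrame
end RankTwo

section LocalResidues

variable {c0 c1 : Fin ℓ → K} {e : (Fin (ℓ - 1) → K) →ₗ[K] (Fin ℓ → K)}
  {A : Arrangement K ℓ} {m : (Fin ℓ → K) → ℕ}

theorem Qpoly_mdel (hc0 : c0 ∈ A.hyps) :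
    Qpoly A (mdel m c0) = linP c0 ^ (m c0 - 1) * ∏ c ∈ A.hyps.erase c0, linP c ^ m c := by
  rw [Qpoly, ← Finset.mul_prod_erase _ _ hc0, mdel_self,
    Finset.prod_congr rfl fun c hc => by rw [mdel_of_ne m (Finset.ne_of_mem_erase hc)]]

theorem isRes_Qpoly_smul (hc0 : c0 ∈ A.hyps) (x : ExtF K ℓ) :
    IsRes c0 e (m c0 - 1) (Qpoly A (mdel m c0) • x)
      (resP e (∏ c ∈ A.hyps.erase c0, linP c ^ m c) • resE e x) :=
  ⟨0, (∏ c ∈ A.hyps.erase c0, linP c ^ m c) • x,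
    by rw [mul_zero, zero_add, smul_smul, Qpoly_mdel hc0], resE_smul _ _⟩

theorem exists_smul_of_isUnit_mul {n : ℕ} {u a : PS K n} (hu : IsUnit u) {x y : ExtF K n}
    (h : (u * a) • x = y) : ∃ u' : PS K n, IsUnit u' ∧ a • x = u' • y := by
  obtain ⟨u, rfl⟩ := hu
  exact ⟨_, u⁻¹.isUnit, by rw [← h, smul_smul, ← mul_assoc, Units.inv_mul, one_mul]⟩

theorem exists_eq_smul_of_isRes (D : HypSplitting c0 e) (hc0 : c0 ∈ A.hyps) (hm : 0 < m c0)
    {v : Fin ℓ → K} (hv0 : dotLin c0 v = 1) (hv1 : dotLin c1 v = 0) {a b : PS K ℓ}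
    (hψ : a • dP c0 + (linP c0 ^ m c0 * b) • dP c1 ∈ logForms A m) {y u s : PS K (ℓ - 1)}
    {d k : ℕ} (hy : y ≠ 0) (hu : IsUnit u) (ha : resP e a = u * y ^ d)
    (hQ : resP e (∏ c ∈ A.hyps.erase c0, linP c ^ m c) = s * y ^ (d + k)) {η : ExtF K ℓ}
    (hη : η ∈ logForms A (mdel m c0)) {τ : ExtF K (ℓ - 1)} (hτ : IsRes c0 e (m c0 - 1) η τ) :
    ∃ τ', τ = y ^ k • τ' := by
  obtain ⟨κ, -, h⟩ := exists_mul_eq_Qpoly_smul (logForms_le_mdel A m c0 hψ) hη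
  obtain ⟨μ, ξ, rfl, rfl⟩ := hτ
  have hpow : linP c0 ^ m c0 = linP c0 ^ (m c0 - 1) * linP c0 := by
    rw [← pow_succ, Nat.sub_add_cancel hm]
  have hα := linP_ne_zero D.ne_zero
  set η := dP c0 * μ + linP c0 ^ (m c0 - 1) • ξ with hηdef
  have h1 : a • (dP c0 * ξ) + (linP c0 * b) • (dP c1 * η) =
      (∏ c ∈ A.hyps.erase c0, linP c ^ m c) • κ := by
    refine smul_cancel (pow_ne_zero (m c0 - 1) hα) ?_
    rw [smul_smul, ← Qpoly_mdel hc0, ← h, add_mul, smul_add, smul_mul_assoc, smul_mul_assoc,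
      smul_smul (linP c0 ^ (m c0 - 1)) (linP c0 * b), ← mul_assoc, ← hpow, add_left_inj, hηdef,
      mul_add, dP, ExteriorAlgebra.ι_mul_ι_mul, zero_add, ← dP, mul_smul_comm, smul_comm]
  have h2 := congrArg (fun x => resE e (contr v x)) h1
  simp only [map_add, LinearMap.map_smul, contr_dP_mul, hv0, hv1, C_1, C_0, one_smul, zero_smul,
    resE_smul, map_sub, map_mul, D.resE_self, D.resP_self, zero_mul, sub_zero, add_zero, ha,
    hQ] at h2
  obtain ⟨u', -, h3⟩ := exists_smul_of_isUnit_mul hu h2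
  refine ⟨(u' * s) • resE e (contr v κ), smul_cancel (pow_ne_zero d hy) ?_⟩
  rw [h3]
  simp only [smul_smul]
  congr 1
  ring

theorem exists_dP_mul_eq_smul_of_isRes (D : HypSplitting c0 e) (hc0 : c0 ∈ A.hyps)
    {c' : Fin (ℓ - 1) → K} {v : Fin ℓ → K} (hv0 : dotLin c0 v = 1) (hv1 : dotLin c1 v = 0)
    (hspan : ∀ c ∈ A.hyps, c ≠ c0 → ∃ s t : K, c1 = s • c0 + t • c) {t : K} (ht : t ≠ 0)
    (hc1 : restrictForm e c1 = t • c') {η : ExtF K ℓ}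
    (hη : η ∈ logForms A (mdel m c0)) {τ : ExtF K (ℓ - 1)} (hτ : IsRes c0 e (m c0 - 1) η τ) :
    ∃ ξ, dP c' * τ = resP e (∏ c ∈ A.hyps.erase c0, linP c ^ m c) • ξ := by
  obtain ⟨μ, ξ, rfl, rfl⟩ := hτ
  obtain ⟨κ, hκ⟩ : ∃ κ, dP c0 * (dP c1 * ξ) = (∏ c ∈ A.hyps.erase c0, linP c ^ m c) • κ := by
    refine exists_eq_prod_smul _ _ ((A.pairwise_isRelPrime m).mono fun c hc =>
      Finset.mem_of_mem_erase hc) _ fun c hc => ?_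
    rw [Finset.mem_erase] at hc
    obtain ⟨s, t, rfl⟩ := hspan c hc.2 hc.1
    obtain ⟨x, hx⟩ := mem_logForms.mp hη c hc.2
    rw [mdel_of_ne m hc.1] at hx
    refine exists_eq_smul_of_isRelPrime (F := ExtF K ℓ) (R := PS K ℓ) (c := linP c0 ^ (m c0 - 1))
      (y := (C t : PS K ℓ) • (dP c0 * x)) (A.isRelPrime_pow m (fun _ => m c0 - 1) hc.2 hc0 hc.1) ?_
    rw [smul_comm, ← mul_smul_comm (linP c ^ m c), ← hx, mul_add (dP c), mul_add (dP c0),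
      dP_add, dP_smul, dP_smul]
    have h0 : ∀ x, dP c0 * (dP c0 * x) = 0 := fun x => ExteriorAlgebra.ι_mul_ι_mul _ _
    have h1 : dP c0 * (dP c * (dP c0 * μ)) = 0 := by
      rw [← mul_assoc, ← mul_assoc, dP, dP, ExteriorAlgebra.ι_mul_mul_ι, zero_mul]
    simp only [add_mul, mul_add, smul_mul_assoc, mul_smul_comm, h0, h1, smul_zero, zero_add,
      smul_comm (C t : PS K ℓ)]
  have h2 := congrArg (fun x => resE e (contr v x)) hκ
  simp only [LinearMap.map_smul, contr_dP_mul, hv0, hv1, C_1, C_0, one_smul, zero_smul, resE_smul,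
    map_sub, map_mul, D.resE_self, zero_mul, sub_zero, resE_dP, hc1, dP_smul, smul_mul_assoc] at h2
  refine ⟨(C t⁻¹ : PS K (ℓ - 1)) • resE e (contr v κ), ?_⟩
  rw [smul_comm, ← h2, smul_smul, ← C_mul, inv_mul_cancel₀ ht, C_1, one_smul]

theorem exists_mem_logForms_isRes (D : HypSplitting c0 e) (hc0 : c0 ∈ A.hyps)
    {c' : Fin (ℓ - 1) → K} (hc' : c' ≠ 0) {a b : PS K ℓ}
    (hθ : a • dP c0 + (linP c0 ^ (m c0 - 1) * b) • dP c1 ∈ logForms A (mdel m c0)) {t : K}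
    (ht : t ≠ 0) (hc1 : restrictForm e c1 = t • c') {u s : PS K (ℓ - 1)} {d k : ℕ} (hu : IsUnit u)
    (hb : resP e b = u * linP c' ^ k) (hs : IsUnit s)
    (hQ : resP e (∏ c ∈ A.hyps.erase c0, linP c ^ m c) = s * linP c' ^ (d + k))
    {τ ξ : ExtF K (ℓ - 1)} (hτ : dP c' * τ = linP c' ^ d • ξ) :
    ∃ ζ ∈ logForms A (mdel m c0), IsRes c0 e (m c0 - 1) ζ (linP c' ^ k • τ) := by
  obtain ⟨τ1, τ2, rfl⟩ := exists_eq_dP_mul_add hc' hτ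
  obtain ⟨u', hu⟩ := hu.exists_right_inv
  obtain ⟨s', hs⟩ := hs.exists_right_inv
  have hres : IsRes c0 e (m c0 - 1) (a • dP c0 + (linP c0 ^ (m c0 - 1) * b) • dP c1)
      (resP e b • resE e (dP c1)) :=
    ⟨algebraMap _ _ a, b • dP c1, by rw [smul_smul, ← Algebra.commutes, ← Algebra.smul_def],
      resE_smul _ _⟩
  refine ⟨_, add_mem (mul_right_mem_logForms hθ (D.liftE ((u' * C t⁻¹) • τ1)))
    (Qpoly_smul_mem_logForms A _ (D.liftE (s' • τ2))), ?_⟩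
  convert (hres.mul_right _).add (isRes_Qpoly_smul hc0 _) using 1
  have h1 : u * linP c' ^ k * C t * (u' * C t⁻¹) = linP c' ^ k := by
    have h1 : (C t : PS K (ℓ - 1)) * C t⁻¹ = 1 := by rw [← C_mul, mul_inv_cancel₀ ht, C_1]
    linear_combination linP c' ^ k * (u * u') * h1 + linP c' ^ k * hu
  have h2 : s * linP c' ^ (d + k) * s' = linP c' ^ k * linP c' ^ d := by
    linear_combination linP c' ^ (d + k) * hs
  rw [hb, hQ, D.resE_liftE, D.resE_liftE, resE_dP, hc1, dP_smul, smul_smul, smul_smul,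
    smul_mul_assoc, mul_smul_comm, smul_smul, h1, h2, smul_add, smul_smul]

end LocalResidues

section EulerLocal

variable {c0 c1 : Fin ℓ → K} {e : (Fin (ℓ - 1) → K) →ₗ[K] (Fin ℓ → K)}
  {A : Arrangement K ℓ} {m : (Fin ℓ → K) → ℕ} {c' : Fin (ℓ - 1) → K}

theorem restrictForm_sub_smul (c d : Fin ℓ → K) (t : K) :
    restrictForm e (c - t • d) = restrictForm e c - t • restrictForm e d := by
  ext1 i
  simp [restrictForm, sub_mul, Finset.mul_sum, mul_assoc]

theorem mem_locOnRestr {c : Fin ℓ → K} :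
    c ∈ (locOnRestr A e c').hyps ↔ c ∈ A.hyps ∧ ∃ t : K, restrictForm e c = t • c' :=
  Finset.mem_filter

theorem HypSplitting.mem_locOnRestr_self (D : HypSplitting c0 e) (hc0 : c0 ∈ A.hyps) :
    c0 ∈ (locOnRestr A e c').hyps :=
  mem_locOnRestr.mpr ⟨hc0, 0, by rw [D.restrictForm_self, zero_smul]⟩

theorem HypSplitting.restrictForm_ne_zero (D : HypSplitting c0 e) (hc0 : c0 ∈ A.hyps)
    {c : Fin ℓ → K} (hc : c ∈ A.hyps) (hne : c ≠ c0) : restrictForm e c ≠ 0 := fun h =>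
  A.nonprop c hc c0 hc0 hne _ (D.eq_smul_of_restrictForm_eq_zero h)

theorem HypSplitting.exists_rankTwoFrame (D : HypSplitting c0 e) (hc0 : c0 ∈ A.hyps)
    (hc1 : c1 ∈ A.hyps) {t : K} (ht : t ≠ 0) (hc' : c' ≠ 0) (hres : restrictForm e c1 = t • c') :
    Nonempty (RankTwoFrame (locOnRestr A e c') c0 c1) := by
  obtain ⟨y, hy⟩ := exists_dotLin_eq_one hc'
  have hw : dotLin c1 (e (t⁻¹ • y)) = 1 := by
    rw [← sum_restrictForm_mul, hres, ← dotLin_apply, map_smul, dotLin_apply]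
    rw [dotLin_apply] at hy
    simp only [Pi.smul_apply, smul_eq_mul, mul_assoc, ← Finset.mul_sum, hy]
    field_simp
  have h0w := D.dot_e (t⁻¹ • y)
  refine ⟨⟨D.v - dotLin c1 D.v • e (t⁻¹ • y), e (t⁻¹ • y), D.mem_locOnRestr_self hc0,
    mem_locOnRestr.mpr ⟨hc1, t, hres⟩, ?_, h0w, ?_, hw, fun c hc => ?_⟩⟩
  · rw [map_sub, map_smul, h0w, D.dot_v, smul_zero, sub_zero]
  · rw [map_sub, map_smul, hw, smul_eq_mul, mul_one, sub_self]
  · obtain ⟨s, hs⟩ := (mem_locOnRestr.mp hc).2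
    have := D.eq_smul_of_restrictForm_eq_zero (u := c - (s * t⁻¹) • c1) (by
      rw [restrictForm_sub_smul, hs, hres, smul_smul, inv_mul_cancel_right₀ ht, sub_self])
    exact ⟨_, _, sub_eq_iff_eq_add.mp this⟩

theorem HypSplitting.exists_resP_prod_eq (D : HypSplitting c0 e) (hc0 : c0 ∈ A.hyps)
    (m : (Fin ℓ → K) → ℕ) : ∃ s : PS K (ℓ - 1), IsUnit s ∧ ∃ N,
      resP e (∏ c ∈ (locOnRestr A e c').hyps.erase c0, linP c ^ m c) = s * linP c' ^ N := by
  rw [map_prod]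
  refine Finset.prod_induction _
    (fun x => ∃ s : PS K (ℓ - 1), IsUnit s ∧ ∃ N, x = s * linP c' ^ N) ?_ ?_ ?_
  · rintro _ _ ⟨s, hs, N, rfl⟩ ⟨s', hs', N', rfl⟩
    exact ⟨_, hs.mul hs', N + N', by ring⟩
  · exact ⟨1, isUnit_one, 0, by simp⟩
  · intro c hc
    rw [Finset.mem_erase, mem_locOnRestr] at hc
    obtain ⟨hne, hcA, t, ht⟩ := hc
    have ht0 : t ≠ 0 := by
      rintro rfl
      exact D.restrictForm_ne_zero hc0 hcA hne (by rw [ht, zero_smul])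
    exact ⟨C t ^ m c, ((isUnit_iff_ne_zero.mpr ht0).map C).pow _, m c,
      by rw [map_pow, resP_linP, ht, linP_smul, mul_pow]⟩

theorem exists_eq_C_mul_of_dvd {f g : PS K ℓ} {d : ℕ} (hf : f.IsHomogeneous d)
    (hg : g.IsHomogeneous d) (hg0 : g ≠ 0) (h : f ∣ g) : ∃ t : K, t ≠ 0 ∧ g = f * C t := by
  obtain ⟨q, rfl⟩ := h
  have h1 := hg.totalDegree hg0
  rw [totalDegree_mul_of_isDomain (left_ne_zero_of_mul hg0) (right_ne_zero_of_mul hg0),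
    hf.totalDegree (left_ne_zero_of_mul hg0)] at h1
  have h2 : q = C (coeff 0 q) := totalDegree_eq_zero_iff_eq_C.mp (by omega)
  refine ⟨coeff 0 q, fun h3 => hg0 ?_, by rw [← h2]⟩
  rw [h2, h3, C_0, mul_zero]

/-- Generators of the local residue module in codimension one. -/
theorem HypSplitting.exists_local_generators (D : HypSplitting c0 e) (hc0 : c0 ∈ A.hyps)
    (hm0 : 0 < m c0) (hm1 : 0 < m c1) (hc' : c' ≠ 0)
    (F : RankTwoFrame (locOnRestr A e c') c0 c1) {d1 d2 : ℕ}
    (h : FreeWithExp (locOnRestr A e c') m (expVec d1 d2))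
    (h' : FreeWithExp (locOnRestr A e c') (mdel m c0) (expVec (d1 - 1) d2)) :
    ∃ (a b a' b' : PS K ℓ) (u u' s : PS K (ℓ - 1)) (k : ℕ),
      a • dP c0 + (linP c0 ^ m c0 * b) • dP c1 ∈ logForms (locOnRestr A e c') m ∧
      a' • dP c0 + (linP c0 ^ (m c0 - 1) * b') • dP c1 ∈
        logForms (locOnRestr A e c') (mdel m c0) ∧
      IsUnit u ∧ resP e a = u * linP c' ^ d2 ∧ IsUnit u' ∧ resP e b' = u' * linP c' ^ k ∧
      IsUnit s ∧ resP e (∏ c ∈ (locOnRestr A e c').hyps.erase c0, linP c ^ m c) =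
        s * linP c' ^ (d2 + k) := by
  obtain ⟨ψ, θ, hψ, hθ, tψ, tθ, hdeg, hw, hwdeg⟩ := F.exists_euler_pair hm0 hm1 h h'
  obtain ⟨s, hs, N, hN⟩ := D.exists_resP_prod_eq (c' := c') hc0 m
  obtain ⟨t, ht, hwt⟩ := exists_eq_C_mul_of_dvd (Qpoly_isHomogeneous _ _) hwdeg hw
    (F.Qpoly_dvd_wedge (logForms_le_mdel _ _ _ hψ) hθ)
  obtain ⟨b, hb⟩ := ι_mem_logForms_dvd hψ F.mem0 F.dot0w
  obtain ⟨b', hb'⟩ := ι_mem_logForms_dvd hθ F.mem0 F.dot0w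
  rw [mdel_self] at hb'
  have hpow : linP c0 ^ m c0 = linP c0 ^ (m c0 - 1) * linP c0 := by
    rw [← pow_succ, Nat.sub_add_cancel hm0]
  rw [F.ι_eq tψ, hb] at hψ
  rw [F.ι_eq tθ, hb'] at hθ
  have hcanc : evalForm F.v ψ * b' - linP c0 * b * evalForm F.v θ =
      (∏ c ∈ (locOnRestr A e c').hyps.erase c0, linP c ^ m c) * C t := by
    refine mul_left_cancel₀ (pow_ne_zero (m c0 - 1) (linP_ne_zero D.ne_zero)) ?_
    rw [← mul_assoc _ _ (C t), ← Qpoly_mdel F.mem0, ← hwt, RankTwoFrame.wedge, hb, hb', hpow]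
    ring
  have hφ := congrArg (resP e) hcanc
  rw [map_sub, map_mul, map_mul, map_mul, D.resP_self, zero_mul, zero_mul, sub_zero, map_mul, hN,
    show resP e (C t) = C t from (resP e).commutes t, mul_right_comm] at hφ
  have hst : IsUnit (s * C t) := hs.mul ((isUnit_iff_ne_zero.mpr ht).map C)
  obtain ⟨i, k, u, u', rfl, huu, hu, hu'⟩ := mul_eq_mul_prime_pow (linP_prime hc') hφ
  rw [huu, IsUnit.mul_iff] at hst
  have hi : i = d2 := by
    have h0 : resP e (evalForm F.v ψ) ≠ 0 := by
      rw [hu]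
      exact mul_ne_zero hst.1.ne_zero (pow_ne_zero _ (linP_ne_zero hc'))
    have h1 : (resP e (evalForm F.v ψ)).IsHomogeneous d2 :=
      linSubst_isHomogeneous _ (evalForm_isHomogeneous _ hdeg)
    have h2 := h1.totalDegree h0
    rw [hu, totalDegree_mul_of_isDomain hst.1.ne_zero (pow_ne_zero _ (linP_ne_zero hc')),
      ((linP_isHomogeneous c').pow i).totalDegree (pow_ne_zero _ (linP_ne_zero hc')),
      (isUnit_iff_totalDegree_of_isReduced.mp hst.1).2] at h2
    omega
  subst hi
  exact ⟨_, b, _, b', u, u', s, k, hψ, hθ, hst.1, hu, hst.2, hu', hs, hN⟩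

end EulerLocal

section ResiduesEq

variable {c0 : Fin ℓ → K} {e : (Fin (ℓ - 1) → K) →ₗ[K] (Fin ℓ → K)}
  {A : Arrangement K ℓ} {m : (Fin ℓ → K) → ℕ}

theorem logForms_anti {A A' : Arrangement K ℓ} (h : A'.hyps ⊆ A.hyps) (m : (Fin ℓ → K) → ℕ) :
    logForms A m ≤ logForms A' m := fun _ hζ =>
  mem_logForms.mpr fun c hc => mem_logForms.mp hζ c (h hc)

theorem prod_sdiff_smul_mem_logForms {A A' : Arrangement K ℓ} {m : (Fin ℓ → K) → ℕ}
    {ζ : ExtF K ℓ} (hζ : ζ ∈ logForms A' m) :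
    (∏ c ∈ A.hyps \ A'.hyps, linP c ^ m c) • ζ ∈ logForms A m := by
  refine mem_logForms.mpr fun c hc => ?_
  rw [mul_smul_comm]
  by_cases hc' : c ∈ A'.hyps
  · obtain ⟨ξ, h⟩ := mem_logForms.mp hζ c hc'
    exact ⟨_, by rw [h, smul_comm]⟩
  · refine ⟨(∏ d ∈ (A.hyps \ A'.hyps).erase c, linP d ^ m d) • (dP c * ζ), ?_⟩
    rw [smul_smul, Finset.mul_prod_erase _ (fun d => linP d ^ m d)
      (Finset.mem_sdiff.mpr ⟨hc, hc'⟩)]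

theorem HypSplitting.not_dvd_resP_prod (D : HypSplitting c0 e) (hc0 : c0 ∈ A.hyps)
    {c' : Fin (ℓ - 1) → K} (hc' : c' ≠ 0) (m : (Fin ℓ → K) → ℕ) :
    ¬ linP c' ∣ resP e (∏ c ∈ A.hyps \ (locOnRestr A e c').hyps, linP c ^ m c) := by
  rw [map_prod, (linP_prime hc').dvd_finsetProd_iff]
  rintro ⟨c, hc, hdvd⟩
  rw [Finset.mem_sdiff] at hc
  rw [map_pow, resP_linP] at hdvd
  have hne : c ≠ c0 := fun h => hc.2 (h ▸ D.mem_locOnRestr_self hc0)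
  exact hc.2 (mem_locOnRestr.mpr ⟨hc.1, (linP_dvd_iff (D.restrictForm_ne_zero hc0 hc.1 hne)).mp
    ((linP_prime hc').dvd_of_dvd_pow hdvd)⟩)

/-- The residue module in codimension one. -/
theorem HypSplitting.exists_local_description (D : HypSplitting c0 e) (hc0 : c0 ∈ A.hyps)
    (hm : ∀ c ∈ A.hyps, 0 < m c) {B : Arrangement K (ℓ - 1)} {ms : (Fin (ℓ - 1) → K) → ℕ}
    (hB : IsRestrictionOf B A c0 e) (hms : IsEulerMult A m c0 e B ms) {c' : Fin (ℓ - 1) → K}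
    (hc' : c' ∈ B.hyps) :
    ∃ k : ℕ,
      (∀ τ ∈ residues D A m, (∃ τ', τ = linP c' ^ k • τ') ∧
        ∃ ξ, dP c' * τ = linP c' ^ (k + ms c') • ξ) ∧
      ∀ τ ξ, dP c' * τ = linP c' ^ ms c' • ξ →
        ∃ g, ¬ linP c' ∣ g ∧ g • linP c' ^ k • τ ∈ residues D A m := by
  obtain ⟨c1, hc1, -, t, ht, hres⟩ := hB.2 c' hc'
  obtain ⟨d1, d2, h, h', hd⟩ := hms c' hc'
  have hc'0 := B.ne_zero c' hc'
  obtain ⟨F⟩ := D.exists_rankTwoFrame hc0 hc1 ht hc'0 hres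
  obtain ⟨a, b, a', b', u, u', s, k, hψ, hθ, hu, ha, hu', hb', hs, hQ⟩ :=
    D.exists_local_generators hc0 (hm c0 hc0) (hm c1 hc1) hc'0 F h h'
  have hsub : (locOnRestr A e c').hyps ⊆ A.hyps := Finset.filter_subset _ _
  have hspan : ∀ c ∈ (locOnRestr A e c').hyps, c ≠ c0 → ∃ s t : K, c1 = s • c0 + t • c := by
    intro c hc hne
    obtain ⟨hcA, r, hr⟩ := mem_locOnRestr.mp hc
    have hr0 : r ≠ 0 := by
      rintro rfl
      exact D.restrictForm_ne_zero hc0 hcA hne (by rw [hr, zero_smul])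
    exact ⟨_, t * r⁻¹, sub_eq_iff_eq_add.mp (D.eq_smul_of_restrictForm_eq_zero (by
      rw [restrictForm_sub_smul, hr, hres, smul_smul, inv_mul_cancel_right₀ hr0, sub_self]))⟩
  subst hd
  refine ⟨k, fun τ hτ => ?_, fun τ ξ hτ => ?_⟩
  · obtain ⟨ζ, hζ, hr⟩ := mem_residues.mp hτ
    have hζ' := logForms_anti hsub _ hζ
    refine ⟨exists_eq_smul_of_isRes D F.mem0 (hm c0 hc0) F.dot0v F.dot1v hψ
      (linP_ne_zero hc'0) hu ha hQ hζ' hr, ?_⟩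
    obtain ⟨ξ, hξ⟩ := exists_dP_mul_eq_smul_of_isRes D F.mem0 F.dot0v F.dot1v hspan ht hres hζ' hr
    exact ⟨s • ξ, by rw [hξ, hQ, smul_smul, add_comm, mul_comm]⟩
  · obtain ⟨ζ, hζ, hr⟩ := exists_mem_logForms_isRes D F.mem0 hc'0 hθ ht hres hu' hb' hs hQ hτ
    have hG := prod_sdiff_smul_mem_logForms (A := A) hζ
    exact ⟨_, D.not_dvd_resP_prod hc0 hc'0 _, mem_residues.mpr ⟨_, hG, hr.smul _⟩⟩

theorem Arrangement.isRelPrime_pow_prod_erase (A : Arrangement K ℓ) (m m' : (Fin ℓ → K) → ℕ)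
    {c : Fin ℓ → K} (hc : c ∈ A.hyps) :
    IsRelPrime (linP c ^ m c) (∏ d ∈ A.hyps.erase c, linP d ^ m' d) :=
  IsRelPrime.prod_right fun _ hd => A.isRelPrime_pow m m' hc (Finset.mem_of_mem_erase hd)
    (Finset.ne_of_mem_erase hd).symm

/-- The residue module is the module of logarithmic forms of the Euler restriction, up to a
polynomial factor. -/
theorem HypSplitting.exists_residues_iff (D : HypSplitting c0 e) (hc0 : c0 ∈ A.hyps)
    (hm : ∀ c ∈ A.hyps, 0 < m c) (hfree : Module.Free (PS K ℓ) (logForms A m))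
    {B : Arrangement K (ℓ - 1)} {ms : (Fin (ℓ - 1) → K) → ℕ} (hB : IsRestrictionOf B A c0 e)
    (hms : IsEulerMult A m c0 e B ms) :
    ∃ k : (Fin (ℓ - 1) → K) → ℕ,
      residues D A m = (logForms B ms).map (LinearMap.lsmul _ (ExtF K (ℓ - 1)) (Qpoly B k)) := by
  have hloc := fun c' (hc' : c' ∈ B.hyps) => D.exists_local_description hc0 hm hB hms hc'
  choose! k hk hk' using hloc
  have hQ : ∀ c' ∈ B.hyps, linP c' ^ k c' * ∏ d ∈ B.hyps.erase c', linP d ^ k d = Qpoly B k :=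
    fun c' hc' => Finset.mul_prod_erase _ (fun d => linP d ^ k d) hc'
  refine ⟨k, le_antisymm (fun τ hτ => ?_) ?_⟩
  · obtain ⟨τ, rfl⟩ := exists_eq_Qpoly_smul fun c' hc' => (hk c' hc' τ hτ).1
    refine ⟨τ, mem_logForms.mpr fun c' hc' => ?_, rfl⟩
    obtain ⟨ξ, hξ⟩ := (hk c' hc' _ hτ).2
    refine exists_eq_smul_of_isRelPrime (F := ExtF K (ℓ - 1)) (y := ξ)
      (B.isRelPrime_pow_prod_erase ms k hc') ?_
    refine smul_cancel (pow_ne_zero (k c') (linP_ne_zero (B.ne_zero c' hc'))) ?_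
    rw [smul_smul, smul_smul, ← pow_add, ← hξ, hQ c' hc', mul_smul_comm]
  · rintro _ ⟨τ, hτ, rfl⟩
    rw [LinearMap.lsmul_apply]
    refine mem_residues_of_forall_prime D hc0 (hm c0 hc0) hfree
      (a := resP e (∏ c ∈ A.hyps.erase c0, linP c ^ m c)) ?_ ?_ fun p hp hdvd => ?_
    · rw [map_prod, Finset.prod_ne_zero_iff]
      intro c hc
      rw [map_pow, resP_linP]
      exact pow_ne_zero _ (linP_ne_zero (D.restrictForm_ne_zero hc0 (Finset.mem_of_mem_erase hc)
        (Finset.ne_of_mem_erase hc)))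
    · have := isRes_Qpoly_smul (e := e) (m := m) hc0 (D.liftE (Qpoly B k • τ))
      rw [D.resE_liftE] at this
      exact mem_residues.mpr ⟨_, Qpoly_smul_mem_logForms _ _ _, this⟩
    · rw [map_prod, hp.dvd_finsetProd_iff] at hdvd
      obtain ⟨c, hc, hdvd⟩ := hdvd
      obtain ⟨c', hc', t, ht, hres⟩ := hB.1 c (Finset.mem_of_mem_erase hc)
        (Finset.ne_of_mem_erase hc)
      rw [map_pow, resP_linP, hres, linP_smul] at hdvd
      have hdvd : p ∣ linP c' :=
        ((isUnit_iff_ne_zero.mpr ht).map C).dvd_mul_left.mp (hp.dvd_of_dvd_pow hdvd)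
      obtain ⟨ξ, hξ⟩ := mem_logForms.mp hτ c' hc'
      obtain ⟨g, hg, hgτ⟩ := hk' c' hc' ((∏ d ∈ B.hyps.erase c', linP d ^ k d) • τ)
        ((∏ d ∈ B.hyps.erase c', linP d ^ k d) • ξ) (by rw [mul_smul_comm, hξ, smul_comm])
      rw [smul_smul (linP c' ^ k c'), hQ c' hc'] at hgτ
      exact ⟨g, hgτ, fun h => hg (((hp.associated_of_dvd
        (linP_prime (B.ne_zero c' hc')) hdvd).dvd_iff_dvd_left).mp h)⟩

theorem free_map_lsmul {R F : Type} [CommRing R] [IsDomain R] [AddCommGroup F] [Module R F]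
    [Module.Free R F] {r : R} (hr : r ≠ 0) (N : Submodule R F) [Module.Free R N] :
    Module.Free R (N.map (LinearMap.lsmul R F r)) :=
  Module.Free.of_equiv (N.equivMapOfInjective _ fun _ _ h => smul_cancel hr h)

end ResiduesEq

/-- If `(A, m)` and the Euler restriction `(A^H, m^*)` are both free, then `(A, m - δ_H)`
is tame. -/
theorem tame_of_free_and_euler_restriction_free
    {K : Type} [Field K] {ℓ : ℕ} (A : Arrangement K ℓ) (hess : Essential A)
    (m : (Fin ℓ → K) → ℕ) (hm : ∀ c ∈ A.hyps, 0 < m c)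
    (c0 : Fin ℓ → K) (hc0 : c0 ∈ A.hyps)
    (hfree : FreeM A m)
    (heuler_free : ∃ (e : (Fin (ℓ - 1) → K) →ₗ[K] (Fin ℓ → K)) (B : Arrangement K (ℓ - 1))
      (ms : (Fin (ℓ - 1) → K) → ℕ),
      IsHypEmbedding c0 e ∧ IsRestrictionOf B A c0 e ∧ IsEulerMult A m c0 e B ms ∧
        FreeM B ms) :
    TameM A (mdel m c0) := by
  obtain ⟨e, B, ms, he, hB, hms, hBfree⟩ := heuler_free
  obtain ⟨v, hv⟩ := exists_dotLin_eq_one (A.ne_zero c0 hc0)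
  obtain ⟨D, -⟩ := he.exists_splitting hv
  have hfree := free_logForms hfree
  have hBfree := free_logForms hBfree
  refine tameM_mdel_of_free_residues D hc0 (hm c0 hc0) hfree ?_
  obtain ⟨k, hk⟩ := D.exists_residues_iff hc0 hm hfree hB hms
  rw [hk]
  exact free_map_lsmul (Qpoly_ne_zero B k) _
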